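/- Let d ≥ 1, r ∈ ℕ, 1 < p < ∞, μ ≥ 0, and 1 ≤ i ≤ d. There exist constants c1, c2 > 0, independent of g, such that for every g ∈ C^{2r}(B^d), c1 ‖φ^{2r} ∂_i^{2r} g‖_{p,μ} ≤ ‖D_{i,i}^{2r} g‖_{p,μ} ≤ c2 ‖φ^{2r} ∂_i^{2r} g‖_{p,μ} + c2 ‖g‖_{p,μ}, where D_{i,i}^{2r} denotes the r-fold composition of the second-order operator D_{i,i}^2. -/

import Mathlib

open MeasureTheory Finset Metric
open scoped ENNReal NNReal Real

noncomputable section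

/-- The differential operator `D_{i,j} = x_j ∂_i − x_i ∂_j` acting on functions on `ℝ^d`. -/
def Dij {d : ℕ} (i j : Fin d) (f : EuclideanSpace ℝ (Fin d) → ℝ) :
    EuclideanSpace ℝ (Fin d) → ℝ :=
  fun x => x j * fderiv ℝ f x (EuclideanSpace.single i 1)
    - x i * fderiv ℝ f x (EuclideanSpace.single j 1)
/-- `φ(x) = √(1−‖x‖²)`. -/
def phiB {d : ℕ} (x : EuclideanSpace ℝ (Fin d)) : ℝ := Real.sqrt (1 - ‖x‖ ^ 2)

/-- The partial derivative `∂_i`. -/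
def pder {d : ℕ} (i : Fin d) (f : EuclideanSpace ℝ (Fin d) → ℝ) :
    EuclideanSpace ℝ (Fin d) → ℝ :=
  fun x => fderiv ℝ f x (EuclideanSpace.single i 1)

/-- The measure `W_ν(x) dx = (1−‖x‖²)^{ν−1/2} dx` on the unit ball `B^d`. -/
def ballMeasure (d : ℕ) (ν : ℝ) : Measure (EuclideanSpace ℝ (Fin d)) :=
  (volume.restrict (Metric.closedBall (0 : EuclideanSpace ℝ (Fin d)) 1)).withDensity
    fun x => ENNReal.ofReal ((1 - ‖x‖ ^ 2) ^ (ν - 1 / 2))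
/-- The operator `g ↦ φ ∂_i g`. -/
def phiD {d : ℕ} (i : Fin d) (h : EuclideanSpace ℝ (Fin d) → ℝ) :
    EuclideanSpace ℝ (Fin d) → ℝ :=
  fun w => phiB w * pder i h w

/-- The operator `g ↦ −φ ∂_i g`. -/
def negPhiD {d : ℕ} (i : Fin d) (h : EuclideanSpace ℝ (Fin d) → ℝ) :
    EuclideanSpace ℝ (Fin d) → ℝ :=
  fun w => -(phiB w * pder i h w)

/-- The second-order operator `D_{i,i}² g = W_μ(x)⁻¹ ∂_i [(1−‖x‖²) W_μ(x) ∂_i g]`. -/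
def DiiOp {d : ℕ} (μ : ℝ) (i : Fin d) (g : EuclideanSpace ℝ (Fin d) → ℝ) :
    EuclideanSpace ℝ (Fin d) → ℝ :=
  fun x => ((1 - ‖x‖ ^ 2) ^ (μ - 1 / 2))⁻¹ *
    pder i (fun y => (1 - ‖y‖ ^ 2) * ((1 - ‖y‖ ^ 2) ^ (μ - 1 / 2)) * pder i g y) x


theorem aux_schur (ν : Measure ℝ) [SFinite ν] {p q : ℝ} (hpq : p.HolderConjugate q)
    (K : ℝ → ℝ → ℝ≥0∞) (hK : Measurable (Function.uncurry K))
    (h : ℝ → ℝ≥0∞) (hh : Measurable h) (hh0 : ∀ᵐ y ∂ν, h y ≠ 0 ∧ h y ≠ ⊤)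
    (A B : ℝ≥0∞)
    (h1 : ∀ᵐ x ∂ν, ∫⁻ y, K x y * h y ^ q ∂ν ≤ A * h x ^ q)
    (h2 : ∀ᵐ y ∂ν, ∫⁻ x, K x y * h x ^ p ∂ν ≤ B * h y ^ p)
    (u f : ℝ → ℝ≥0∞) (hf : Measurable f)
    (hu : ∀ᵐ x ∂ν, u x ≤ ∫⁻ y, K x y * f y ∂ν) :
    ∫⁻ x, u x ^ p ∂ν ≤ A ^ (p / q) * B * ∫⁻ y, f y ^ p ∂ν := by
  have hp := hpq.pos
  have hq := hpq.symm.pos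
  have hsum : 1 / p + 1 / q = 1 := by
    have := hpq.inv_add_inv_eq_one
    simpa [one_div] using this
  have hKx : ∀ x, Measurable (K x) := fun x => hK.comp (measurable_const.prodMk measurable_id)
  have key : ∀ᵐ x ∂ν, u x ^ p ≤ A ^ (p / q) *
      ∫⁻ y, h x ^ p * (K x y * (f y ^ p * (h y)⁻¹ ^ p)) ∂ν := by
    filter_upwards [hu, h1] with x hx hx1
    have e1 : ∫⁻ y, K x y * f y ∂ν =
        ∫⁻ y, ((fun y => K x y ^ (1 / p) * (f y * (h y)⁻¹)) * (fun y => K x y ^ (1 / q) * h y)) y ∂ν := by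
      apply lintegral_congr_ae
      filter_upwards [hh0] with y hy
      simp only [Pi.mul_apply]
      have : K x y = K x y ^ (1 / p) * K x y ^ (1 / q) := by
        rw [← ENNReal.rpow_add_of_nonneg _ _ (by positivity) (by positivity), hsum, ENNReal.rpow_one]
      calc K x y * f y = (K x y ^ (1 / p) * K x y ^ (1 / q)) * f y * ((h y)⁻¹ * h y) := by
            rw [ENNReal.inv_mul_cancel hy.1 hy.2, mul_one, ← this]
        _ = _ := by ring
    have hol := ENNReal.lintegral_mul_le_Lp_mul_Lq ν hpq
      (f := fun y => K x y ^ (1 / p) * (f y * (h y)⁻¹)) (g := fun y => K x y ^ (1 / q) * h y)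
      (by have := hKx x; fun_prop) (by have := hKx x; fun_prop)
    rw [← e1] at hol
    have e2 : ∫⁻ y, (K x y ^ (1 / p) * (f y * (h y)⁻¹)) ^ p ∂ν = ∫⁻ y, K x y * (f y ^ p * (h y)⁻¹ ^ p) ∂ν := by
      congr 1; ext y
      rw [ENNReal.mul_rpow_of_nonneg _ _ hp.le, ENNReal.mul_rpow_of_nonneg _ _ hp.le, ← ENNReal.rpow_mul,
        one_div_mul_cancel hp.ne', ENNReal.rpow_one]
    have e3 : ∫⁻ y, (K x y ^ (1 / q) * h y) ^ q ∂ν = ∫⁻ y, K x y * h y ^ q ∂ν := by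
      congr 1; ext y
      rw [ENNReal.mul_rpow_of_nonneg _ _ hq.le, ← ENNReal.rpow_mul,
        one_div_mul_cancel hq.ne', ENNReal.rpow_one]
    rw [e2, e3] at hol
    rw [lintegral_const_mul _ (by have := hKx x; fun_prop)]
    calc u x ^ p ≤ ((∫⁻ y, K x y * (f y ^ p * (h y)⁻¹ ^ p) ∂ν) ^ (1 / p) * (A * h x ^ q) ^ (1 / q)) ^ p := by
          apply ENNReal.rpow_le_rpow _ hp.le
          refine (hx.trans hol).trans ?_
          gcongr
      _ = (∫⁻ y, K x y * (f y ^ p * (h y)⁻¹ ^ p) ∂ν) * (A ^ (p / q) * h x ^ p) := by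
          rw [ENNReal.mul_rpow_of_nonneg _ _ hp.le, ← ENNReal.rpow_mul, one_div_mul_cancel hp.ne', ENNReal.rpow_one,
            ← ENNReal.rpow_mul, ENNReal.mul_rpow_of_nonneg _ _ (by positivity), ← ENNReal.rpow_mul]
          congr 3 <;> field_simp
      _ = _ := by ring
  have hm : Measurable (Function.uncurry fun x y => h x ^ p * (K x y * (f y ^ p * (h y)⁻¹ ^ p))) := by
    have hK' : Measurable fun z : ℝ × ℝ => K z.1 z.2 := hK
    unfold Function.uncurry
    fun_prop
  calc ∫⁻ x, u x ^ p ∂ν ≤ ∫⁻ x, A ^ (p / q) *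
      ∫⁻ y, h x ^ p * (K x y * (f y ^ p * (h y)⁻¹ ^ p)) ∂ν ∂ν := lintegral_mono_ae key
    _ = A ^ (p / q) * ∫⁻ x, ∫⁻ y, h x ^ p * (K x y * (f y ^ p * (h y)⁻¹ ^ p)) ∂ν ∂ν := by
        rw [lintegral_const_mul]
        exact hm.lintegral_prod_right
    _ = A ^ (p / q) * ∫⁻ y, ∫⁻ x, h x ^ p * (K x y * (f y ^ p * (h y)⁻¹ ^ p)) ∂ν ∂ν := by
        rw [lintegral_lintegral_swap hm.aemeasurable]
    _ ≤ A ^ (p / q) * ∫⁻ y, B * f y ^ p ∂ν := by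
        gcongr 1
        apply lintegral_mono_ae
        filter_upwards [h2, hh0] with y hy hy0
        have hKy : Measurable fun x => K x y := hK.comp (measurable_id.prodMk measurable_const)
        calc ∫⁻ x, h x ^ p * (K x y * (f y ^ p * (h y)⁻¹ ^ p)) ∂ν
            = ∫⁻ x, (f y ^ p * (h y)⁻¹ ^ p) * (K x y * h x ^ p) ∂ν := by
              congr 1; ext x; ring
          _ = (f y ^ p * (h y)⁻¹ ^ p) * ∫⁻ x, (K x y * h x ^ p) ∂ν := by
              rw [lintegral_const_mul]; fun_prop
          _ ≤ (f y ^ p * (h y)⁻¹ ^ p) * (B * h y ^ p) := by gcongr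
          _ = B * f y ^ p * ((h y)⁻¹ * h y) ^ p := by
              rw [ENNReal.mul_rpow_of_nonneg _ _ hp.le]; ring
          _ = B * f y ^ p := by rw [ENNReal.inv_mul_cancel hy0.1 hy0.2]; simp
    _ = _ := by
        rw [lintegral_const_mul _ (by fun_prop)]; ring

theorem aux_even (G : ℝ → ℝ≥0∞) (hG : Measurable G) :
    ∫⁻ y, G |y| ≤ 2 * ∫⁻ y in Set.Ici 0, G y := by
  have hm : Measurable ((Set.Ici (0:ℝ)).indicator G) := hG.indicator measurableSet_Ici
  calc ∫⁻ y, G |y| ≤ ∫⁻ y, ((Set.Ici (0:ℝ)).indicator G y + (Set.Ici (0:ℝ)).indicator G (-y)) := by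
        apply lintegral_mono
        intro y
        rcases le_total 0 y with h | h
        · simp [abs_of_nonneg h, Set.indicator, h]
        · simp [abs_of_nonpos h, Set.indicator, h]
    _ = (∫⁻ y, (Set.Ici (0:ℝ)).indicator G y) + ∫⁻ y, (Set.Ici (0:ℝ)).indicator G (-y) := by
        rw [lintegral_add_left hm]
    _ = _ := by
        rw [lintegral_neg_eq_self (fun y => (Set.Ici (0:ℝ)).indicator G y), lintegral_indicator measurableSet_Ici, two_mul]

theorem aux_int_half (e : ℝ) (a b M : ℝ) (hab : a ≤ b) (hI : IntervalIntegrable (fun y => (1 - y) ^ e) volume a b)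
    (hb : b ≤ 1)
    (hM : ∫ y in a..b, (1 - y) ^ e ≤ M) :
    ∫⁻ y in Set.Ioc a b, ENNReal.ofReal ((1 - y) ^ e) ≤ ENNReal.ofReal M := by
  rw [intervalIntegral.integral_of_le hab] at hM
  rw [intervalIntegrable_iff_integrableOn_Ioc_of_le hab] at hI
  rw [← ofReal_integral_eq_lintegral_ofReal hI]
  · exact ENNReal.ofReal_le_ofReal hM
  · refine (ae_restrict_iff' measurableSet_Ioc).2 (Filter.Eventually.of_forall fun y hy => ?_)
    exact Real.rpow_nonneg (by linarith [hy.2]) _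

theorem aux_I1 (c : ℝ) (hc : 0 < c) : ∃ C : ℝ≥0, ∀ x : ℝ, |x| < 1 →
    ∫⁻ y, (Set.Ioo |x| 1).indicator (fun y => ENNReal.ofReal ((1 - y ^ 2) ^ (c - 1))) |y|
      ≤ C * ENNReal.ofReal ((1 - x ^ 2) ^ c) := by
  refine ⟨Real.toNNReal (2 * 2 ^ c / c), fun x hx => ?_⟩
  have hm : Measurable ((Set.Ioo |x| 1).indicator (fun y : ℝ => ENNReal.ofReal ((1 - y ^ 2) ^ (c - 1)))) := by
    apply Measurable.indicator _ measurableSet_Ioo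
    fun_prop
  refine (aux_even _ hm).trans ?_
  have hr := abs_nonneg x
  have hxx : x ^ 2 = |x| ^ 2 := (sq_abs x).symm
  rw [hxx]
  set r := |x|
  have hI : IntervalIntegrable (fun y : ℝ => (1 - y) ^ (c - 1)) volume r 1 := by
    have := (intervalIntegral.intervalIntegrable_rpow' (a := 0) (b := 1 - r) (r := c - 1) (by linarith)).comp_sub_left 1
    simpa using this.symm
  have hv : ∫ y in r..1, (1 - y) ^ (c - 1) ≤ (1 - r) ^ c / c := by
    rw [intervalIntegral.integral_comp_sub_left (fun y => y ^ (c - 1)), integral_rpow (Or.inl (by linarith))]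
    simp [Real.zero_rpow hc.ne']
  have h2 := aux_int_half (c - 1) r 1 _ hx.le hI le_rfl hv
  calc 2 * ∫⁻ y in Set.Ici 0, (Set.Ioo r 1).indicator (fun y : ℝ => ENNReal.ofReal ((1 - y ^ 2) ^ (c - 1))) y
      ≤ 2 * ∫⁻ y, (Set.Ioc r 1).indicator (fun y : ℝ => ENNReal.ofReal (2 ^ c) * ENNReal.ofReal ((1 - y) ^ (c - 1))) y := by
        gcongr 1
        refine (setLIntegral_le_lintegral _ _).trans (lintegral_mono fun y => ?_)
        by_cases hy : y ∈ Set.Ioo r 1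
        · rw [Set.indicator_of_mem hy, Set.indicator_of_mem (Set.Ioo_subset_Ioc_self hy), ← ENNReal.ofReal_mul (by positivity)]
          apply ENNReal.ofReal_le_ofReal
          have h0 : 0 < y := lt_of_le_of_lt hr hy.1
          have h1 : 0 < 1 - y := by linarith [hy.2]
          rw [show 1 - y ^ 2 = (1 + y) * (1 - y) by ring, Real.mul_rpow (by linarith) h1.le]
          gcongr
          calc (1 + y) ^ (c - 1) ≤ (1 + y) ^ c := Real.rpow_le_rpow_of_exponent_le (by linarith) (by linarith)
            _ ≤ 2 ^ c := by gcongr; linarith [hy.2]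
        · rw [Set.indicator_of_notMem hy]; exact zero_le
    _ = 2 * (ENNReal.ofReal (2 ^ c) * ∫⁻ y in Set.Ioc r 1, ENNReal.ofReal ((1 - y) ^ (c - 1))) := by
        rw [lintegral_indicator measurableSet_Ioc, lintegral_const_mul _ (by fun_prop)]
    _ ≤ 2 * (ENNReal.ofReal (2 ^ c) * ENNReal.ofReal ((1 - r ^ 2) ^ c / c)) := by
        gcongr 2
        refine h2.trans (ENNReal.ofReal_le_ofReal ?_)
        have : r ^ 2 ≤ r := by nlinarith
        have : 0 ≤ 1 - r := by linarith
        gcongr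
    _ = _ := by
        rw [← ENNReal.ofReal.eq_1, show (2:ℝ≥0∞) = ENNReal.ofReal 2 by simp, ← ENNReal.ofReal_mul (by positivity),
          ← ENNReal.ofReal_mul (by positivity), ← ENNReal.ofReal_mul (by positivity)]
        congr 1; ring

theorem aux_I2 (c : ℝ) (hc : 0 < c) : ∃ C : ℝ≥0, ∀ x : ℝ, |x| < 1 →
    ∫⁻ y, (Set.Iio |x|).indicator (fun y => ENNReal.ofReal ((1 - y ^ 2) ^ (- c - 1))) |y|
      ≤ C * ENNReal.ofReal ((1 - x ^ 2) ^ (- c)) := by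
  refine ⟨Real.toNNReal (2 * 2 ^ c / c), fun x hx => ?_⟩
  have hm : Measurable ((Set.Iio |x|).indicator (fun y : ℝ => ENNReal.ofReal ((1 - y ^ 2) ^ (- c - 1)))) := by
    apply Measurable.indicator _ measurableSet_Iio
    fun_prop
  refine (aux_even _ hm).trans ?_
  have hr := abs_nonneg x
  have hxx : x ^ 2 = |x| ^ 2 := (sq_abs x).symm
  rw [hxx]
  set r := |x|
  have hI : IntervalIntegrable (fun y : ℝ => (1 - y) ^ (- c - 1)) volume 0 r := by
    apply ContinuousOn.intervalIntegrable
    rw [Set.uIcc_of_le hr]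
    apply ContinuousOn.rpow_const (by fun_prop)
    intro y hy; left; linarith [hy.2]
  have hv : ∫ y in (0:ℝ)..r, (1 - y) ^ (- c - 1) ≤ (1 - r) ^ (-c) / c := by
    rw [intervalIntegral.integral_comp_sub_left (fun y => y ^ (- c - 1)), integral_rpow]
    · simp only [sub_zero, sub_add_cancel, Real.one_rpow]
      rw [div_neg, ← neg_div]
      gcongr
      linarith
    · right
      refine ⟨by linarith, ?_⟩
      rw [Set.uIcc_of_le (by linarith)]
      intro h
      linarith [h.1]
  have h2 := aux_int_half (- c - 1) 0 r _ hr hI hx.le hv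
  calc 2 * ∫⁻ y in Set.Ici 0, (Set.Iio r).indicator (fun y : ℝ => ENNReal.ofReal ((1 - y ^ 2) ^ (- c - 1))) y
      ≤ 2 * ∫⁻ y in Set.Ici 0, (Set.Iic r).indicator (fun y : ℝ => ENNReal.ofReal ((1 - y) ^ (- c - 1))) y := by
        gcongr 1
        apply setLIntegral_mono' measurableSet_Ici
        intro y hy0
        have h0 : 0 ≤ y := hy0
        by_cases hy : y ∈ Set.Iio r
        · have hy' : y < r := hy
          rw [Set.indicator_of_mem hy, Set.indicator_of_mem (by exact hy'.le)]
          apply ENNReal.ofReal_le_ofReal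
          apply Real.rpow_le_rpow_of_nonpos (by linarith) (by nlinarith) (by linarith)
        · rw [Set.indicator_of_notMem hy]; exact zero_le
    _ = 2 * (∫⁻ y in Set.Ioc 0 r, ENNReal.ofReal ((1 - y) ^ (- c - 1))) := by
        rw [setLIntegral_indicator measurableSet_Iic, Set.inter_comm, Set.Ici_inter_Iic,
          Measure.restrict_congr_set Ioc_ae_eq_Icc]
    _ ≤ 2 * (ENNReal.ofReal (2 ^ c) * ENNReal.ofReal ((1 - r ^ 2) ^ (-c) / c)) := by
        gcongr 1
        refine h2.trans ?_
        rw [← ENNReal.ofReal_mul (by positivity)]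
        refine (ENNReal.ofReal_le_ofReal ?_)
        rw [← mul_div_assoc]
        gcongr
        rw [show 1 - r ^ 2 = (1 + r) * (1 - r) by ring, Real.mul_rpow (by linarith) (by linarith), ← mul_assoc]
        apply le_mul_of_one_le_left (Real.rpow_nonneg (by linarith) _)
        rw [Real.rpow_neg (by linarith), ← div_eq_mul_inv, one_le_div (by positivity)]
        gcongr; linarith
    _ = _ := by
        have : 0 ≤ 1 - r ^ 2 := by nlinarith
        rw [← ENNReal.ofReal.eq_1, show (2:ℝ≥0∞) = ENNReal.ofReal 2 by simp, ← ENNReal.ofReal_mul (by positivity),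
          ← ENNReal.ofReal_mul (by positivity), ← ENNReal.ofReal_mul (by positivity)]
        congr 1; ring

def nuM (κ : ℝ) : Measure ℝ :=
  (volume.restrict (Set.Ioo (-1) 1)).withDensity fun t => ENNReal.ofReal ((1 - t ^ 2) ^ (κ - 1))

instance (κ : ℝ) : SFinite (nuM κ) := by unfold nuM; infer_instance

theorem nu_lint (κ : ℝ) (G : ℝ → ℝ≥0∞) :
    ∫⁻ y, G y ∂(nuM κ) = ∫⁻ y in Set.Ioo (-1) 1, ENNReal.ofReal ((1 - y ^ 2) ^ (κ - 1)) * G y := by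
  unfold nuM
  rw [lintegral_withDensity_eq_lintegral_mul_non_measurable _ (by fun_prop)]
  · rfl
  · exact Filter.Eventually.of_forall fun x => ENNReal.ofReal_lt_top

theorem nu_ae (κ : ℝ) : ∀ᵐ y ∂(nuM κ), y ∈ Set.Ioo (-1:ℝ) 1 := by
  apply (withDensity_absolutelyContinuous _ _).ae_le
  exact ae_restrict_mem measurableSet_Ioo

theorem pos_of_Ioo {x : ℝ} (hx : x ∈ Set.Ioo (-1:ℝ) 1) : 0 < 1 - x ^ 2 := by
  nlinarith [hx.1, hx.2]

theorem ofReal_rpow_mul {x : ℝ} (hx : x ∈ Set.Ioo (-1:ℝ) 1) (a b : ℝ) :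
    ENNReal.ofReal ((1 - x ^ 2) ^ a) * ENNReal.ofReal ((1 - x ^ 2) ^ b) = ENNReal.ofReal ((1 - x ^ 2) ^ (a + b)) := by
  have := pos_of_Ioo hx
  rw [← ENNReal.ofReal_mul (by positivity), Real.rpow_add this]

theorem ofReal_rpow_rpow {x : ℝ} (hx : x ∈ Set.Ioo (-1:ℝ) 1) (a b : ℝ) :
    ENNReal.ofReal ((1 - x ^ 2) ^ a) ^ b = ENNReal.ofReal ((1 - x ^ 2) ^ (a * b)) := by
  have := pos_of_Ioo hx
  rw [ENNReal.ofReal_rpow_of_pos (by positivity), Real.rpow_mul this.le]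

theorem aux_hardy {p q : ℝ} (hpq : p.HolderConjugate q) (κ α γ : ℝ) (χ : ℝ → ℝ → ℝ≥0∞)
    (hχ : Measurable (Function.uncurry χ)) (A B : ℝ≥0)
    (hA : ∀ x ∈ Set.Ioo (-1:ℝ) 1, ∫⁻ y in Set.Ioo (-1) 1, χ x y * ENNReal.ofReal ((1 - y ^ 2) ^ (- α - γ * q - 1))
      ≤ A * ENNReal.ofReal ((1 - x ^ 2) ^ (- α - γ * q)))
    (hB : ∀ y ∈ Set.Ioo (-1:ℝ) 1, ∫⁻ x in Set.Ioo (-1) 1, χ x y * ENNReal.ofReal ((1 - x ^ 2) ^ (α - γ * p + κ - 1))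
      ≤ B * ENNReal.ofReal ((1 - y ^ 2) ^ (α - γ * p + κ))) :
    ∃ C : ℝ≥0, ∀ u f : ℝ → ℝ≥0∞, Measurable f →
      (∀ x ∈ Set.Ioo (-1:ℝ) 1, u x ≤ ∫⁻ y in Set.Ioo (-1) 1, χ x y *
        (ENNReal.ofReal ((1 - x ^ 2) ^ α) * ENNReal.ofReal ((1 - y ^ 2) ^ (- α - 1))) * f y) →
      ∫⁻ x, u x ^ p ∂(nuM κ) ≤ C * ∫⁻ y, f y ^ p ∂(nuM κ) := by
  have hp := hpq.pos
  have hq := hpq.symm.pos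
  refine ⟨A ^ (p / q) * B, fun u f hf hu => ?_⟩
  rw [ENNReal.coe_mul, ENNReal.coe_rpow_of_nonneg _ (by positivity)]
  refine aux_schur (nuM κ) hpq
    (fun x y => χ x y * (ENNReal.ofReal ((1 - x ^ 2) ^ α) * ENNReal.ofReal ((1 - y ^ 2) ^ (- α - κ)))) ?_
    (fun x => ENNReal.ofReal ((1 - x ^ 2) ^ (-γ))) (by fun_prop) ?_ A B ?_ ?_ u f hf ?_
  · have : Measurable fun z : ℝ × ℝ => χ z.1 z.2 := hχ
    unfold Function.uncurry
    fun_prop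
  · filter_upwards [nu_ae κ] with x hx
    have := pos_of_Ioo hx
    refine ⟨?_, ENNReal.ofReal_ne_top⟩
    simp only [ne_eq, ENNReal.ofReal_eq_zero, not_le]
    positivity
  · filter_upwards [nu_ae κ] with x hx
    rw [nu_lint]
    have hm : Measurable fun y => χ x y := hχ.comp (measurable_const.prodMk measurable_id)
    calc _ = ∫⁻ y in Set.Ioo (-1) 1, ENNReal.ofReal ((1 - x ^ 2) ^ α) *
            (χ x y * ENNReal.ofReal ((1 - y ^ 2) ^ (- α - γ * q - 1))) := by
          apply setLIntegral_congr_fun measurableSet_Ioo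
          intro y hy
          simp only
          rw [ofReal_rpow_rpow hy]
          calc _ = ENNReal.ofReal ((1 - x ^ 2) ^ α) * (χ x y * (ENNReal.ofReal ((1 - y ^ 2) ^ (κ - 1)) *
                ENNReal.ofReal ((1 - y ^ 2) ^ (- α - κ)) * ENNReal.ofReal ((1 - y ^ 2) ^ (-γ * q)))) := by ring
            _ = _ := by
              rw [ofReal_rpow_mul hy, ofReal_rpow_mul hy]
              ring_nf
      _ = ENNReal.ofReal ((1 - x ^ 2) ^ α) * ∫⁻ y in Set.Ioo (-1) 1,
            (χ x y * ENNReal.ofReal ((1 - y ^ 2) ^ (- α - γ * q - 1))) := by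
          rw [lintegral_const_mul]; fun_prop
      _ ≤ ENNReal.ofReal ((1 - x ^ 2) ^ α) * (A * ENNReal.ofReal ((1 - x ^ 2) ^ (- α - γ * q))) := by
          gcongr 1; exact hA x hx
      _ = A * (ENNReal.ofReal ((1 - x ^ 2) ^ α) * ENNReal.ofReal ((1 - x ^ 2) ^ (- α - γ * q))) := by ring
      _ = _ := by
          rw [ofReal_rpow_mul hx, ofReal_rpow_rpow hx]; ring_nf
  · filter_upwards [nu_ae κ] with y hy
    rw [nu_lint]
    have hm : Measurable fun x => χ x y := hχ.comp (measurable_id.prodMk measurable_const)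
    calc _ = ∫⁻ x in Set.Ioo (-1) 1, ENNReal.ofReal ((1 - y ^ 2) ^ (- α - κ)) *
            (χ x y * ENNReal.ofReal ((1 - x ^ 2) ^ (α - γ * p + κ - 1))) := by
          apply setLIntegral_congr_fun measurableSet_Ioo
          intro x hx
          simp only
          rw [ofReal_rpow_rpow hx]
          calc _ = ENNReal.ofReal ((1 - y ^ 2) ^ (- α - κ)) * (χ x y * (ENNReal.ofReal ((1 - x ^ 2) ^ (κ - 1)) *
                ENNReal.ofReal ((1 - x ^ 2) ^ α) * ENNReal.ofReal ((1 - x ^ 2) ^ (-γ * p)))) := by ring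
            _ = _ := by
              rw [ofReal_rpow_mul hx, ofReal_rpow_mul hx]
              ring_nf
      _ = ENNReal.ofReal ((1 - y ^ 2) ^ (- α - κ)) * ∫⁻ x in Set.Ioo (-1) 1,
            (χ x y * ENNReal.ofReal ((1 - x ^ 2) ^ (α - γ * p + κ - 1))) := by
          rw [lintegral_const_mul]; fun_prop
      _ ≤ ENNReal.ofReal ((1 - y ^ 2) ^ (- α - κ)) * (B * ENNReal.ofReal ((1 - y ^ 2) ^ (α - γ * p + κ))) := by
          gcongr 1; exact hB y hy
      _ = B * (ENNReal.ofReal ((1 - y ^ 2) ^ (- α - κ)) * ENNReal.ofReal ((1 - y ^ 2) ^ (α - γ * p + κ))) := by ring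
      _ = _ := by
          rw [ofReal_rpow_mul hy, ofReal_rpow_rpow hy]; ring_nf
  · filter_upwards [nu_ae κ] with x hx
    refine (hu x hx).trans (le_of_eq ?_)
    rw [nu_lint]
    apply setLIntegral_congr_fun measurableSet_Ioo
    intro y hy
    simp only
    calc χ x y * (ENNReal.ofReal ((1 - x ^ 2) ^ α) * ENNReal.ofReal ((1 - y ^ 2) ^ (- α - 1))) * f y
        = χ x y * (ENNReal.ofReal ((1 - x ^ 2) ^ α) * (ENNReal.ofReal ((1 - y ^ 2) ^ (κ - 1)) *
          ENNReal.ofReal ((1 - y ^ 2) ^ (- α - κ)))) * f y := by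
          rw [ofReal_rpow_mul hy]; ring_nf
      _ = _ := by ring

/-- characteristic function of `|y| < |x|` -/
def chiF (x y : ℝ) : ℝ≥0∞ := {z : ℝ × ℝ | |z.2| < |z.1|}.indicator (fun _ => 1) (x, y)

theorem chiF_meas : Measurable (Function.uncurry chiF) := by
  have : Function.uncurry chiF = {z : ℝ × ℝ | |z.2| < |z.1|}.indicator (fun _ => 1) := by
    ext z; rfl
  rw [this]
  exact measurable_const.indicator (measurableSet_lt (by fun_prop) (by fun_prop))

theorem aux_J1 (c : ℝ) (hc : 0 < c) : ∃ C : ℝ≥0, ∀ x ∈ Set.Ioo (-1:ℝ) 1,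
    ∫⁻ y in Set.Ioo (-1) 1, chiF y x * ENNReal.ofReal ((1 - y ^ 2) ^ (c - 1))
      ≤ C * ENNReal.ofReal ((1 - x ^ 2) ^ c) := by
  obtain ⟨C, hC⟩ := aux_I1 c hc
  refine ⟨C, fun x hx => le_trans ?_ (hC x (abs_lt.2 hx))⟩
  rw [← lintegral_indicator measurableSet_Ioo]
  apply lintegral_mono
  intro y
  by_cases hy : y ∈ Set.Ioo (-1:ℝ) 1
  · by_cases h : |x| < |y|
    · simp [Set.indicator, chiF, hy, h, abs_lt.2 hy]
    · simp [Set.indicator, chiF, h]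
  · simp [Set.indicator, hy]

theorem aux_J2 (c : ℝ) (hc : 0 < c) : ∃ C : ℝ≥0, ∀ x ∈ Set.Ioo (-1:ℝ) 1,
    ∫⁻ y in Set.Ioo (-1) 1, chiF x y * ENNReal.ofReal ((1 - y ^ 2) ^ (- c - 1))
      ≤ C * ENNReal.ofReal ((1 - x ^ 2) ^ (-c)) := by
  obtain ⟨C, hC⟩ := aux_I2 c hc
  refine ⟨C, fun x hx => le_trans ?_ (hC x (abs_lt.2 hx))⟩
  refine (setLIntegral_le_lintegral _ _).trans ?_
  apply lintegral_mono
  intro y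
  by_cases h : |y| < |x|
  · simp [Set.indicator, chiF, h]
  · simp [Set.indicator, chiF, h]

/-- outer Hardy inequality -/
theorem hardy1 {p : ℝ} (hp : 1 < p) (κ : ℝ) (hκ : 0 < κ) (m : ℕ) :
    ∃ C : ℝ≥0, ∀ u f : ℝ → ℝ≥0∞, Measurable f →
      (∀ x ∈ Set.Ioo (-1:ℝ) 1, u x ≤ ∫⁻ y in Set.Ioo (-1) 1, chiF y x *
        (ENNReal.ofReal ((1 - x ^ 2) ^ (-(κ + m))) * ENNReal.ofReal ((1 - y ^ 2) ^ (κ + m - 1))) * f y) →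
      ∫⁻ x, u x ^ p ∂(nuM κ) ≤ C * ∫⁻ y, f y ^ p ∂(nuM κ) := by
  have hpq := Real.HolderConjugate.conjExponent hp
  set q := Real.conjExponent p
  have hp0 := hpq.pos
  have hq := hpq.symm.pos
  set γ := κ / (2 * q)
  have hγ : 0 < γ := by positivity
  have hγq : γ * q = κ / 2 := by simp only [γ]; field_simp
  obtain ⟨A, hA⟩ := aux_J1 (κ + m - γ * q) (by rw [hγq]; have : (0:ℝ) ≤ m := by positivity
                                               linarith)
  obtain ⟨B, hB⟩ := aux_J2 (m + γ * p) (by positivity)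
  have := aux_hardy hpq κ (-(κ + m)) γ (fun x y => chiF y x) (chiF_meas.comp measurable_swap) A B
    (by simpa only [neg_neg] using hA)
    (by
      have e : -(κ + m) - γ * p + κ = - (m + γ * p) := by ring
      rw [e]; exact hB)
  simpa only [neg_neg] using this

/-- inner Hardy inequality -/
theorem hardy2 {p : ℝ} (hp : 1 < p) (κ : ℝ) (hκ : 0 < κ) (m : ℕ) :
    ∃ C : ℝ≥0, ∀ u f : ℝ → ℝ≥0∞, Measurable f →
      (∀ x ∈ Set.Ioo (-1:ℝ) 1, u x ≤ ∫⁻ y in Set.Ioo (-1) 1, chiF x y *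
        (ENNReal.ofReal ((1 - x ^ 2) ^ (m : ℝ)) * ENNReal.ofReal ((1 - y ^ 2) ^ (-(m:ℝ) - 1))) * f y) →
      ∫⁻ x, u x ^ p ∂(nuM κ) ≤ C * ∫⁻ y, f y ^ p ∂(nuM κ) := by
  have hpq := Real.HolderConjugate.conjExponent hp
  set q := Real.conjExponent p
  have hp0 := hpq.pos
  have hq := hpq.symm.pos
  set γ := κ / (2 * p)
  have hγ : 0 < γ := by positivity
  have hγp : γ * p = κ / 2 := by simp only [γ]; field_simp
  have hm0 : (0:ℝ) ≤ m := by positivity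
  obtain ⟨A, hA⟩ := aux_J2 (m + γ * q) (by positivity)
  obtain ⟨B, hB⟩ := aux_J1 (m - γ * p + κ) (by rw [hγp]; linarith)
  exact aux_hardy hpq κ m γ chiF chiF_meas A B
    (by
      have e : -(m:ℝ) - γ * q = - (m + γ * q) := by ring
      rw [e]; exact hA) hB

def Sm (n : ℕ) (f : ℝ → ℝ) : Prop := ContDiffOn ℝ n f (Set.Icc (-1) 1)

def dW (f : ℝ → ℝ) : ℝ → ℝ := derivWithin f (Set.Icc (-1) 1)

def NN (p κ : ℝ) (m : ℕ) (f : ℝ → ℝ) : ℝ≥0∞ :=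
  eLpNorm (fun t => (1 - t ^ 2) ^ m * f t) (ENNReal.ofReal p) (nuM κ)

theorem uIcc1 : UniqueDiffOn ℝ (Set.Icc (-1:ℝ) 1) := uniqueDiffOn_Icc (by norm_num)

theorem Sm.mono {n k : ℕ} {f : ℝ → ℝ} (h : Sm n f) (hk : k ≤ n) : Sm k f :=
  ContDiffOn.of_le h (by exact_mod_cast hk)

theorem Sm.dW {n : ℕ} {f : ℝ → ℝ} (h : Sm (n + 1) f) : Sm n (dW f) :=
  ContDiffOn.derivWithin h uIcc1 (by push_cast; exact le_rfl)

theorem Sm.iter {n : ℕ} (k : ℕ) {f : ℝ → ℝ} (h : Sm (n + k) f) : Sm n (_root_.dW^[k] f) := by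
  induction k generalizing f with
  | zero => exact h
  | succ k ih =>
    rw [Function.iterate_succ_apply]
    exact ih (Sm.dW h)

theorem Sm.cont {n : ℕ} {f : ℝ → ℝ} (h : Sm n f) : ContinuousOn f (Set.Icc (-1) 1) :=
  ContDiffOn.continuousOn h

theorem Sm.hasDeriv {n : ℕ} {f : ℝ → ℝ} (h : Sm (n + 1) f) {x : ℝ} (hx : x ∈ Set.Ioo (-1:ℝ) 1) :
    HasDerivAt f (_root_.dW f x) x := by
  have h1 : DifferentiableOn ℝ f (Set.Icc (-1) 1) := ContDiffOn.differentiableOn h (by simp)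
  exact (h1 x (Set.Ioo_subset_Icc_self hx)).hasDerivWithinAt.hasDerivAt (Icc_mem_nhds hx.1 hx.2)

theorem aesm_of_cont (κ : ℝ) {f : ℝ → ℝ} (h : ContinuousOn f (Set.Icc (-1) 1)) :
    AEStronglyMeasurable f (nuM κ) := by
  have : AEStronglyMeasurable f (volume.restrict (Set.Ioo (-1) 1)) :=
    (h.mono Set.Ioo_subset_Icc_self).aestronglyMeasurable measurableSet_Ioo
  exact this.mono_ac (withDensity_absolutelyContinuous _ _)

theorem aux_enorm_ftc (G G' : ℝ → ℝ) {a b : ℝ} (hab : a ≤ b) (hc : ContinuousOn G (Set.Icc a b))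
    (hd : ∀ x ∈ Set.Ioo a b, HasDerivAt G (G' x) x) :
    ‖G b - G a‖ₑ ≤ ∫⁻ x in Set.Ioo a b, ‖G' x‖ₑ := by
  by_cases hfin : ∫⁻ x in Set.Ioo a b, ‖G' x‖ₑ = ⊤
  · rw [hfin]; exact le_top
  have hm : AEStronglyMeasurable G' (volume.restrict (Set.Ioo a b)) := by
    refine (aestronglyMeasurable_deriv G _).congr ?_
    refine (ae_restrict_iff' measurableSet_Ioo).2 (Filter.Eventually.of_forall fun y hy => ?_)
    exact (hd y hy).deriv
  have hi : IntegrableOn G' (Set.Ioo a b) := ⟨hm, lt_top_iff_ne_top.2 hfin⟩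
  have := intervalIntegral.integral_eq_sub_of_hasDerivAt_of_le hab hc hd
    ((intervalIntegrable_iff_integrableOn_Ioo_of_le hab).2 hi)
  rw [← this, intervalIntegral.integral_of_le hab, integral_Ioc_eq_integral_Ioo]
  exact enorm_integral_le_lintegral_enorm _

theorem eLp_of_lint {p : ℝ} (hp : 1 < p) (κ : ℝ) (C : ℝ≥0) (u f : ℝ → ℝ)
    (h : ∫⁻ x, ‖u x‖ₑ ^ p ∂(nuM κ) ≤ C * ∫⁻ x, ‖f x‖ₑ ^ p ∂(nuM κ)) :
    eLpNorm u (ENNReal.ofReal p) (nuM κ) ≤ (C ^ (1 / p) : ℝ≥0) * eLpNorm f (ENNReal.ofReal p) (nuM κ) := by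
  have h0 : ENNReal.ofReal p ≠ 0 := by simp; linarith
  rw [eLpNorm_eq_lintegral_rpow_enorm_toReal h0 ENNReal.ofReal_ne_top,
    eLpNorm_eq_lintegral_rpow_enorm_toReal h0 ENNReal.ofReal_ne_top, ENNReal.toReal_ofReal (by linarith),
    ENNReal.coe_rpow_of_nonneg _ (by positivity), ← ENNReal.mul_rpow_of_nonneg _ _ (by positivity)]
  exact ENNReal.rpow_le_rpow h (by positivity)

theorem Sm_bd {f : ℝ → ℝ} (h : ContinuousOn f (Set.Icc (-1) 1)) : Measurable ((Set.Ioo (-1:ℝ) 1).indicator f) := by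
  have : Set.indicator (Set.Ioo (-1:ℝ) 1) f = Set.piecewise (Set.Ioo (-1:ℝ) 1) f 0 := by
    rw [Set.piecewise_eq_indicator]
  rw [this]
  exact (h.mono Set.Ioo_subset_Icc_self).measurable_piecewise continuousOn_const measurableSet_Ioo

theorem lint_ind (κ : ℝ) (f : ℝ → ℝ) (p : ℝ) :
    ∫⁻ x, ‖(Set.Ioo (-1:ℝ) 1).indicator f x‖ₑ ^ p ∂(nuM κ) = ∫⁻ x, ‖f x‖ₑ ^ p ∂(nuM κ) := by
  apply lintegral_congr_ae
  filter_upwards [nu_ae κ] with x hx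
  rw [Set.indicator_of_mem hx]

theorem enorm_pow_mul {x : ℝ} (hx : x ∈ Set.Ioo (-1:ℝ) 1) (m : ℕ) (a : ℝ) :
    ‖(1 - x ^ 2) ^ m * a‖ₑ = ENNReal.ofReal ((1 - x ^ 2) ^ (m : ℝ)) * ‖a‖ₑ := by
  have := pos_of_Ioo hx
  rw [enorm_mul, Real.rpow_natCast, Real.enorm_of_nonneg (by positivity)]

theorem H1 {p : ℝ} (hp : 1 < p) (κ : ℝ) (hκ : 0 < κ) (m : ℕ) : ∃ C : ℝ≥0, ∀ v : ℝ → ℝ, Sm 1 v →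
    NN p κ m v ≤ C * NN p κ m (fun t => (1 - t ^ 2) * dW v t - 2 * (κ + 2 * m) * t * v t) := by
  obtain ⟨C, hC⟩ := hardy1 hp κ hκ m
  refine ⟨C ^ (1 / p), fun v hv => ?_⟩
  apply eLp_of_lint hp
  set a := κ + 2 * m with ha_def
  have ha : 0 < a := by positivity
  set F : ℝ → ℝ := fun t => (1 - t ^ 2) * dW v t - 2 * a * t * v t with hF
  have hvc := hv.cont
  have hdc := (Sm.dW (n := 0) hv).cont
  have hFc : ContinuousOn (fun t => (1 - t ^ 2) ^ m * F t) (Set.Icc (-1) 1) := by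
    simp only [hF]; fun_prop
  rw [← lint_ind κ (fun t => (1 - t ^ 2) ^ m * F t)]
  refine hC _ (fun x => ‖(Set.Ioo (-1:ℝ) 1).indicator (fun t => (1 - t ^ 2) ^ m * F t) x‖ₑ) (Sm_bd hFc).enorm ?_
  intro x hx
  set G : ℝ → ℝ := fun t => (1 - t ^ 2) ^ a * v t with hG
  set G' : ℝ → ℝ := fun t => (1 - t ^ 2) ^ (a - 1) * F t with hG'
  have hGc : ContinuousOn G (Set.Icc (-1) 1) := by
    apply ContinuousOn.mul _ hvc
    exact ContinuousOn.rpow_const (by fun_prop) (fun _ _ => Or.inr ha.le)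
  have hGd : ∀ t ∈ Set.Ioo (-1:ℝ) 1, HasDerivAt G (G' t) t := by
    intro t ht
    have hpos := pos_of_Ioo ht
    have h1 : HasDerivAt (fun t : ℝ => 1 - t ^ 2) (-(2 * t)) t := by
      simpa using (hasDerivAt_pow 2 t).const_sub 1
    have h2 := (h1.rpow_const (p := a) (Or.inl hpos.ne')).mul (Sm.hasDeriv (n := 0) hv ht)
    refine HasDerivAt.congr_deriv h2 ?_
    change _ = (1 - t ^ 2) ^ (a - 1) * ((1 - t ^ 2) * dW v t - 2 * a * t * v t)
    have : (1 - t ^ 2) ^ a = (1 - t ^ 2) ^ (a - 1) * (1 - t ^ 2) := by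
      rw [Real.rpow_sub_one hpos.ne']; field_simp
    rw [this]; ring
  have hG1 : G 1 = 0 := by simp [hG, Real.zero_rpow ha.ne']
  have hG2 : G (-1) = 0 := by simp [hG, Real.zero_rpow ha.ne']
  have key : ‖G x‖ₑ ≤ ∫⁻ y in Set.Ioo (-1) 1, chiF y x * ‖G' y‖ₑ := by
    have hb : ∀ c d : ℝ, Set.Ioo c d ⊆ Set.Ioo (-1) 1 → (∀ y ∈ Set.Ioo c d, |x| < |y|) →
        ∫⁻ y in Set.Ioo c d, ‖G' y‖ₑ ≤ ∫⁻ y in Set.Ioo (-1) 1, chiF y x * ‖G' y‖ₑ := by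
      intro c d hcd hy
      calc ∫⁻ y in Set.Ioo c d, ‖G' y‖ₑ = ∫⁻ y in Set.Ioo c d, chiF y x * ‖G' y‖ₑ := by
            apply setLIntegral_congr_fun measurableSet_Ioo
            intro y hyy
            simp [chiF, hy y hyy]
        _ ≤ _ := lintegral_mono_set hcd
    rcases le_total 0 x with h0 | h0
    · have := aux_enorm_ftc G G' hx.2.le (hGc.mono (Set.Icc_subset_Icc hx.1.le le_rfl))
        (fun t ht => hGd t ⟨hx.1.trans ht.1, ht.2⟩)
      rw [hG1, zero_sub, enorm_neg] at this
      refine this.trans (hb _ _ (Set.Ioo_subset_Ioo hx.1.le le_rfl) fun y hy => ?_)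
      rw [abs_of_nonneg h0, abs_of_nonneg (h0.trans hy.1.le)]; exact hy.1
    · have := aux_enorm_ftc G G' hx.1.le (hGc.mono (Set.Icc_subset_Icc le_rfl hx.2.le))
        (fun t ht => hGd t ⟨ht.1, ht.2.trans hx.2⟩)
      rw [hG2, sub_zero] at this
      refine this.trans (hb _ _ (Set.Ioo_subset_Ioo le_rfl hx.2.le) fun y hy => ?_)
      rw [abs_of_nonpos h0, abs_of_nonpos (hy.2.le.trans h0)]; linarith [hy.2]
  have hpos := pos_of_Ioo hx
  calc ‖(1 - x ^ 2) ^ m * v x‖ₑ = ENNReal.ofReal ((1 - x ^ 2) ^ (-(κ + m))) * ‖G x‖ₑ := by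
        rw [enorm_pow_mul hx]
        simp only [hG]
        rw [enorm_mul, Real.enorm_of_nonneg (r := (1 - x ^ 2) ^ a) (by positivity), ← mul_assoc, ofReal_rpow_mul hx]
        congr 4
        rw [ha_def]; ring
    _ ≤ ENNReal.ofReal ((1 - x ^ 2) ^ (-(κ + m))) * ∫⁻ y in Set.Ioo (-1) 1, chiF y x * ‖G' y‖ₑ := by gcongr
    _ = ∫⁻ y in Set.Ioo (-1) 1, ENNReal.ofReal ((1 - x ^ 2) ^ (-(κ + m))) * (chiF y x * ‖G' y‖ₑ) := by
        rw [lintegral_const_mul' _ _ ENNReal.ofReal_ne_top]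
    _ = _ := by
        apply setLIntegral_congr_fun measurableSet_Ioo
        intro y hy
        simp only
        have hposy := pos_of_Ioo hy
        rw [Set.indicator_of_mem hy, enorm_pow_mul hy]
        simp only [hG']
        rw [enorm_mul, Real.enorm_of_nonneg (by positivity)]
        have : a - 1 = (κ + m - 1) + m := by rw [ha_def]; ring
        rw [this, ← ofReal_rpow_mul hy]
        ring

theorem H2 {p : ℝ} (hp : 1 < p) (κ : ℝ) (hκ : 0 < κ) (m : ℕ) : ∃ C : ℝ≥0, ∀ v : ℝ → ℝ, Sm 1 v →
    NN p κ m (fun t => v t - v 0) ≤ C * NN p κ (m + 1) (dW v) := by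
  obtain ⟨C, hC⟩ := hardy2 hp κ hκ m
  refine ⟨C ^ (1 / p), fun v hv => ?_⟩
  apply eLp_of_lint hp
  have hvc := hv.cont
  have hdc := (Sm.dW (n := 0) hv).cont
  have hFc : ContinuousOn (fun t => (1 - t ^ 2) ^ (m + 1) * dW v t) (Set.Icc (-1) 1) := by
    fun_prop
  rw [← lint_ind κ (fun t => (1 - t ^ 2) ^ (m + 1) * dW v t)]
  refine hC _ (fun x => ‖(Set.Ioo (-1:ℝ) 1).indicator (fun t => (1 - t ^ 2) ^ (m + 1) * dW v t) x‖ₑ) (Sm_bd hFc).enorm ?_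
  intro x hx
  have hGd : ∀ t ∈ Set.Ioo (-1:ℝ) 1, HasDerivAt v (dW v t) t := fun t ht => Sm.hasDeriv (n := 0) hv ht
  have key : ‖v x - v 0‖ₑ ≤ ∫⁻ y in Set.Ioo (-1) 1, chiF x y * ‖dW v y‖ₑ := by
    have hb : ∀ c d : ℝ, Set.Ioo c d ⊆ Set.Ioo (-1) 1 → (∀ y ∈ Set.Ioo c d, |y| < |x|) →
        ∫⁻ y in Set.Ioo c d, ‖dW v y‖ₑ ≤ ∫⁻ y in Set.Ioo (-1) 1, chiF x y * ‖dW v y‖ₑ := by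
      intro c d hcd hy
      calc ∫⁻ y in Set.Ioo c d, ‖dW v y‖ₑ = ∫⁻ y in Set.Ioo c d, chiF x y * ‖dW v y‖ₑ := by
            apply setLIntegral_congr_fun measurableSet_Ioo
            intro y hyy
            simp [chiF, hy y hyy]
        _ ≤ _ := lintegral_mono_set hcd
    rcases le_total 0 x with h0 | h0
    · have := aux_enorm_ftc v (dW v) h0 (hvc.mono (Set.Icc_subset_Icc (by norm_num) hx.2.le))
        (fun t ht => hGd t ⟨by linarith [ht.1], ht.2.trans hx.2⟩)
      refine this.trans (hb _ _ (Set.Ioo_subset_Ioo (by norm_num) hx.2.le) fun y hy => ?_)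
      rw [abs_of_nonneg h0, abs_of_nonneg hy.1.le]; exact hy.2
    · have := aux_enorm_ftc v (dW v) h0 (hvc.mono (Set.Icc_subset_Icc hx.1.le (by norm_num)))
        (fun t ht => hGd t ⟨hx.1.trans ht.1, by linarith [ht.2]⟩)
      rw [enorm_sub_rev] at this
      refine this.trans (hb _ _ (Set.Ioo_subset_Ioo hx.1.le (by norm_num)) fun y hy => ?_)
      rw [abs_of_nonpos h0, abs_of_nonpos hy.2.le]; linarith [hy.1]
  have hpos := pos_of_Ioo hx
  calc ‖(1 - x ^ 2) ^ m * (v x - v 0)‖ₑ = ENNReal.ofReal ((1 - x ^ 2) ^ (m:ℝ)) * ‖v x - v 0‖ₑ := by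
        rw [enorm_pow_mul hx]
    _ ≤ ENNReal.ofReal ((1 - x ^ 2) ^ (m:ℝ)) * ∫⁻ y in Set.Ioo (-1) 1, chiF x y * ‖dW v y‖ₑ := by gcongr
    _ = ∫⁻ y in Set.Ioo (-1) 1, ENNReal.ofReal ((1 - x ^ 2) ^ (m:ℝ)) * (chiF x y * ‖dW v y‖ₑ) := by
        rw [lintegral_const_mul' _ _ ENNReal.ofReal_ne_top]
    _ = _ := by
        apply setLIntegral_congr_fun measurableSet_Ioo
        intro y hy
        simp only
        have hposy := pos_of_Ioo hy
        rw [Set.indicator_of_mem hy, enorm_pow_mul hy]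
        have : chiF x y * (ENNReal.ofReal ((1 - x ^ 2) ^ (m:ℝ)) * ENNReal.ofReal ((1 - y ^ 2) ^ (-(m:ℝ) - 1))) *
          (ENNReal.ofReal ((1 - y ^ 2) ^ (((m + 1 : ℕ)):ℝ)) * ‖dW v y‖ₑ) =
          ENNReal.ofReal ((1 - x ^ 2) ^ (m:ℝ)) * (chiF x y * ((ENNReal.ofReal ((1 - y ^ 2) ^ (-(m:ℝ) - 1))
            * ENNReal.ofReal ((1 - y ^ 2) ^ (((m + 1 : ℕ)):ℝ))) * ‖dW v y‖ₑ)) := by ring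
        rw [this, ofReal_rpow_mul hy]
        have e : -(m:ℝ) - 1 + ((m + 1 : ℕ):ℝ) = 0 := by push_cast; ring
        rw [e]; simp

theorem nu_fin (κ : ℝ) (hκ : 0 < κ) : nuM κ Set.univ < ⊤ := by
  obtain ⟨C, hC⟩ := aux_J1 κ hκ
  have h := hC 0 (by norm_num)
  have e : nuM κ Set.univ = ∫⁻ y in Set.Ioo (-1:ℝ) 1, chiF y 0 * ENNReal.ofReal ((1 - y ^ 2) ^ (κ - 1)) := by
    rw [← lintegral_one, nu_lint]
    apply lintegral_congr_ae
    have : ∀ᵐ y ∂(volume.restrict (Set.Ioo (-1:ℝ) 1)), y ≠ 0 := by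
      apply ae_restrict_of_ae
      simp [ae_iff]
    filter_upwards [this] with y hy
    simp [chiF, hy]
  rw [e]
  refine h.trans_lt ?_
  exact ENNReal.mul_lt_top ENNReal.coe_lt_top ENNReal.ofReal_lt_top

instance nu_finite (κ : ℝ) [hκ : Fact (0 < κ)] : IsFiniteMeasure (nuM κ) := ⟨nu_fin κ hκ.out⟩

/-- L1 norm on the middle interval controlled by the weighted norm -/
theorem mid_le {p : ℝ} (hp : 1 < p) (κ : ℝ) (hκ : 0 < κ) (m : ℕ) : ∃ C : ℝ≥0, ∀ f : ℝ → ℝ,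
    ContinuousOn f (Set.Icc (-1) 1) →
    ∫⁻ y in Set.Ioo (-(1/2)) (1/2), ‖f y‖ₑ ≤ C * NN p κ m f := by
  set M := nuM κ Set.univ ^ (1 - 1 / p) with hM
  have hMt : M ≠ ⊤ := ENNReal.rpow_ne_top_of_nonneg (by
    have : 1 / p ≤ 1 := by rw [div_le_one (by linarith)]; exact hp.le
    linarith) (nu_fin κ hκ).ne
  refine ⟨Real.toNNReal (((3/4:ℝ) ^ (κ + m))⁻¹) * M.toNNReal, fun f hf => ?_⟩
  rw [ENNReal.coe_mul, ENNReal.coe_toNNReal hMt]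
  have hc : ContinuousOn (fun t => (1 - t ^ 2) ^ m * f t) (Set.Icc (-1) 1) := by fun_prop
  have h1 : eLpNorm (fun t => (1 - t ^ 2) ^ m * f t) 1 (nuM κ) ≤ NN p κ m f * M := by
    have := eLpNorm_le_eLpNorm_mul_rpow_measure_univ (p := 1) (q := ENNReal.ofReal p)
      (by simpa using hp.le) (aesm_of_cont κ hc)
    simpa [NN, hM, ENNReal.toReal_ofReal (by linarith : 0 ≤ p)] using this
  rw [eLpNorm_one_eq_lintegral_enorm, nu_lint] at h1
  calc ∫⁻ y in Set.Ioo (-(1/2)) (1/2), ‖f y‖ₑ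
      ≤ ∫⁻ y in Set.Ioo (-(1/2)) (1/2), ENNReal.ofReal (((3/4:ℝ) ^ (κ + m))⁻¹) *
          (ENNReal.ofReal ((1 - y ^ 2) ^ (κ - 1)) * ‖(1 - y ^ 2) ^ m * f y‖ₑ) := by
        apply setLIntegral_mono' measurableSet_Ioo
        intro y hy
        have hy' : y ∈ Set.Ioo (-1:ℝ) 1 := ⟨by linarith [hy.1], by linarith [hy.2]⟩
        have hpos := pos_of_Ioo hy'
        rw [enorm_pow_mul hy', ← mul_assoc, ← mul_assoc, mul_assoc (ENNReal.ofReal _), ofReal_rpow_mul hy',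
          ← ENNReal.ofReal_mul (by positivity)]
        apply le_mul_of_one_le_left zero_le
        rw [ENNReal.one_le_ofReal, inv_mul_eq_div, one_le_div (by positivity)]
        have h34 : 3/4 ≤ 1 - y ^ 2 := by nlinarith [hy.1, hy.2]
        calc (3/4:ℝ) ^ (κ + m) ≤ (1 - y ^ 2) ^ (κ + m) := by gcongr
          _ ≤ _ := Real.rpow_le_rpow_of_exponent_ge hpos (by nlinarith) (by linarith)
    _ = ENNReal.ofReal (((3/4:ℝ) ^ (κ + m))⁻¹) * ∫⁻ y in Set.Ioo (-(1/2)) (1/2),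
          (ENNReal.ofReal ((1 - y ^ 2) ^ (κ - 1)) * ‖(1 - y ^ 2) ^ m * f y‖ₑ) := by
        rw [lintegral_const_mul' _ _ ENNReal.ofReal_ne_top]
    _ ≤ ENNReal.ofReal (((3/4:ℝ) ^ (κ + m))⁻¹) * ∫⁻ y in Set.Ioo (-1) 1,
          (ENNReal.ofReal ((1 - y ^ 2) ^ (κ - 1)) * ‖(1 - y ^ 2) ^ m * f y‖ₑ) := by
        gcongr 1
        exact lintegral_mono_set (Set.Ioo_subset_Ioo (by norm_num) (by norm_num))
    _ ≤ ENNReal.ofReal (((3/4:ℝ) ^ (κ + m))⁻¹) * (NN p κ m f * M) := by gcongr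
    _ = _ := by rw [ENNReal.ofReal]; ring

theorem test_le (j : ℕ) : ∀ ψ : ℝ → ℝ, ContDiff ℝ (⊤ : ℕ∞) ψ → tsupport ψ ⊆ Set.Ioo (-(1/2)) (1/2) →
    ∃ C : ℝ≥0, ∀ f : ℝ → ℝ, Sm j f →
      ‖∫ t in (-(1/2):ℝ)..(1/2), ψ t * dW^[j] f t‖ₑ ≤ C * ∫⁻ y in Set.Ioo (-(1/2)) (1/2), ‖f y‖ₑ := by
  induction j with
  | zero =>
    intro ψ hψ hs
    obtain ⟨M, hM⟩ := (isCompact_Icc (a := (-(1/2):ℝ)) (b := 1/2)).exists_bound_of_continuousOn hψ.continuous.continuousOn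
    refine ⟨Real.toNNReal M, fun f hf => ?_⟩
    rw [intervalIntegral.integral_of_le (by norm_num), integral_Ioc_eq_integral_Ioo]
    refine (enorm_integral_le_lintegral_enorm _).trans ?_
    rw [← lintegral_const_mul' _ _ ENNReal.coe_ne_top]
    apply setLIntegral_mono' measurableSet_Ioo
    intro y hy
    rw [Function.iterate_zero, id, enorm_mul]
    gcongr
    rw [← ofReal_norm]
    exact ENNReal.ofReal_le_ofReal (hM y (Set.Ioo_subset_Icc_self hy))
  | succ j ih =>
    intro ψ hψ hs
    have hψ' : ContDiff ℝ (⊤ : ℕ∞) (deriv ψ) := by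
      apply ContDiff.deriv'
      exact hψ
    obtain ⟨C, hC⟩ := ih (deriv ψ) hψ' ((tsupport_deriv_subset (𝕜 := ℝ)).trans hs)
    refine ⟨C, fun f hf => ?_⟩
    have hh : Sm 1 (dW^[j] f) := Sm.iter j (by rwa [add_comm])
    have hf' : Sm j f := hf.mono (Nat.le_succ j)
    have hsub : Set.Icc (-(1/2):ℝ) (1/2) ⊆ Set.Ioo (-1:ℝ) 1 := fun t ht => ⟨by linarith [ht.1], by linarith [ht.2]⟩
    have hz : ∀ x : ℝ, x ∉ Set.Ioo (-(1/2):ℝ) (1/2) → ψ x = 0 := fun x hx =>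
      image_eq_zero_of_notMem_tsupport fun h => hx (hs h)
    have hle : (-(1/2):ℝ) ≤ 1/2 := by norm_num
    have ibp := intervalIntegral.integral_mul_deriv_eq_deriv_mul (a := (-(1/2):ℝ)) (b := 1/2)
      (u := ψ) (u' := deriv ψ) (v := dW^[j] f) (v' := dW (dW^[j] f))
      (fun x _ => (hψ.differentiable (by simp) x).hasDerivAt)
      (fun x hx => Sm.hasDeriv (n := 0) hh (hsub (by rwa [Set.uIcc_of_le hle] at hx)))
      (hψ'.continuous.intervalIntegrable _ _)
      (by
        apply ContinuousOn.intervalIntegrable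
        rw [Set.uIcc_of_le hle]
        exact (Sm.dW (n := 0) hh).cont.mono (hsub.trans Set.Ioo_subset_Icc_self))
    rw [Function.iterate_succ_apply', ibp, hz _ (by simp), hz _ (by simp)]
    simp only [zero_mul, sub_zero, zero_sub, enorm_neg]
    exact hC f hf'

theorem exists_test : ∃ ψ : ℝ → ℝ, ContDiff ℝ (⊤ : ℕ∞) ψ ∧ tsupport ψ ⊆ Set.Ioo (-(1/2)) (1/2) ∧
    ∫ t in (-(1/2):ℝ)..(1/2), ψ t = 1 := by
  let φ : ContDiffBump (0:ℝ) := ⟨1/8, 1/4, by norm_num, by norm_num⟩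
  have hs : tsupport (φ.normed volume) ⊆ Set.Ioo (-(1/2)) (1/2) := by
    rw [φ.tsupport_normed_eq, Real.closedBall_eq_Icc]
    intro x hx
    have h1 := hx.1
    have h2 := hx.2
    simp only [φ] at h1 h2
    constructor <;> linarith
  refine ⟨φ.normed volume, φ.contDiff_normed, hs, ?_⟩
  rw [intervalIntegral.integral_of_le (by norm_num), setIntegral_eq_integral_of_forall_compl_eq_zero, φ.integral_normed]
  intro x hx
  apply image_eq_zero_of_notMem_tsupport
  intro h
  exact hx (Set.Ioo_subset_Ioc_self (hs h))

theorem H3 {p : ℝ} (hp : 1 < p) (κ : ℝ) (hκ : 0 < κ) (m j : ℕ) : ∃ C : ℝ≥0, ∀ f : ℝ → ℝ, Sm (j + 1) f →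
    ‖dW^[j] f 0‖ₑ ≤ C * (NN p κ m (dW^[j + 1] f) + NN p κ 0 f) := by
  obtain ⟨ψ, hψ, hs, hint⟩ := exists_test
  obtain ⟨C1, hC1⟩ := test_le j ψ hψ hs
  obtain ⟨C2, hC2⟩ := mid_le hp κ hκ 0
  obtain ⟨C3, hC3⟩ := mid_le hp κ hκ m
  have hψi : ∫⁻ y in Set.Ioo (-(1/2):ℝ) (1/2), ‖ψ y‖ₑ ≠ ⊤ := by
    have h1 : IntegrableOn ψ (Set.Icc (-(1/2):ℝ) (1/2)) volume := hψ.continuous.integrableOn_Icc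
    have h2 : IntegrableOn ψ (Set.Ioo (-(1/2):ℝ) (1/2)) volume := h1.mono_set Set.Ioo_subset_Icc_self
    exact h2.2.ne
  set P := ∫⁻ y in Set.Ioo (-(1/2):ℝ) (1/2), ‖ψ y‖ₑ with hP
  refine ⟨C1 * C2 + P.toNNReal * C3, fun f hf => ?_⟩
  have hf' : Sm j f := hf.mono (Nat.le_succ j)
  set h := dW^[j] f with hh_def
  have hh : Sm 1 h := Sm.iter j (by rwa [add_comm])
  rw [Function.iterate_succ_apply', ← hh_def]
  have hle : (-(1/2):ℝ) ≤ 1/2 := by norm_num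
  have hsub : Set.Icc (-(1/2):ℝ) (1/2) ⊆ Set.Icc (-1:ℝ) 1 := fun t ht => ⟨by linarith [ht.1], by linarith [ht.2]⟩
  have hsub' : Set.Icc (-(1/2):ℝ) (1/2) ⊆ Set.Ioo (-1:ℝ) 1 := fun t ht => ⟨by linarith [ht.1], by linarith [ht.2]⟩
  have hhc : ContinuousOn h (Set.uIcc (-(1/2):ℝ) (1/2)) := by
    rw [Set.uIcc_of_le hle]; exact hh.cont.mono hsub
  have hψc := hψ.continuous
  have e : h 0 = (∫ t in (-(1/2):ℝ)..(1/2), ψ t * h t) + ∫ t in (-(1/2):ℝ)..(1/2), ψ t * (h 0 - h t) := by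
    rw [← intervalIntegral.integral_add (ContinuousOn.intervalIntegrable (by fun_prop))
      (ContinuousOn.intervalIntegrable (by fun_prop))]
    have : ∀ t, ψ t * h t + ψ t * (h 0 - h t) = ψ t * h 0 := fun t => by ring
    simp only [this]
    rw [intervalIntegral.integral_mul_const, hint, one_mul]
  have hb2 : ‖∫ t in (-(1/2):ℝ)..(1/2), ψ t * (h 0 - h t)‖ₑ ≤ P * ∫⁻ y in Set.Ioo (-(1/2)) (1/2), ‖dW h y‖ₑ := by
    rw [intervalIntegral.integral_of_le hle, integral_Ioc_eq_integral_Ioo]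
    refine (enorm_integral_le_lintegral_enorm _).trans ?_
    rw [hP, ← lintegral_mul_const _ (by fun_prop)]
    apply setLIntegral_mono' measurableSet_Ioo
    intro y hy
    rw [enorm_mul]
    gcongr
    rcases le_total 0 y with h0 | h0
    · rw [enorm_sub_rev]
      refine (aux_enorm_ftc h (dW h) h0 (hh.cont.mono (Set.Icc_subset_Icc (by norm_num) (by linarith [hy.2]))) ?_).trans ?_
      · intro x hx
        exact Sm.hasDeriv (n := 0) hh ⟨by linarith [hx.1], by linarith [hx.2, hy.2]⟩
      · exact lintegral_mono_set (Set.Ioo_subset_Ioo (by norm_num) hy.2.le)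
    · refine (aux_enorm_ftc h (dW h) h0 (hh.cont.mono (Set.Icc_subset_Icc (by linarith [hy.1]) (by norm_num))) ?_).trans ?_
      · intro x hx
        exact Sm.hasDeriv (n := 0) hh ⟨by linarith [hx.1, hy.1], by linarith [hx.2]⟩
      · exact lintegral_mono_set (Set.Ioo_subset_Ioo hy.1.le (by norm_num))
  calc ‖h 0‖ₑ ≤ ‖∫ t in (-(1/2):ℝ)..(1/2), ψ t * h t‖ₑ + ‖∫ t in (-(1/2):ℝ)..(1/2), ψ t * (h 0 - h t)‖ₑ := by
        conv_lhs => rw [e]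
        exact enorm_add_le _ _
    _ ≤ C1 * (C2 * NN p κ 0 f) + P * (C3 * NN p κ m (dW h)) := by
        gcongr
        · refine (hC1 f hf').trans ?_
          gcongr
          exact hC2 f hf.cont
        · refine hb2.trans ?_
          gcongr
          exact hC3 _ (Sm.dW (n := 0) hh).cont
    _ ≤ _ := by
        rw [ENNReal.coe_add, ENNReal.coe_mul, ENNReal.coe_mul, ENNReal.coe_toNNReal hψi, add_mul, mul_add, mul_add]
        refine add_le_add ?_ ?_
        · rw [← mul_assoc]; exact le_add_self
        · rw [← mul_assoc]; exact le_self_add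

theorem one_le_ofReal {p : ℝ} (hp : 1 < p) : (1:ℝ≥0∞) ≤ ENNReal.ofReal p := by
  rw [ENNReal.one_le_ofReal]; exact hp.le

theorem NN_add {p : ℝ} (hp : 1 < p) (κ : ℝ) (m : ℕ) {f g : ℝ → ℝ} (hf : ContinuousOn f (Set.Icc (-1) 1))
    (hg : ContinuousOn g (Set.Icc (-1) 1)) :
    NN p κ m (fun t => f t + g t) ≤ NN p κ m f + NN p κ m g := by
  unfold NN
  have h1 : ContinuousOn (fun t => (1 - t ^ 2) ^ m * f t) (Set.Icc (-1) 1) := by fun_prop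
  have h2 : ContinuousOn (fun t => (1 - t ^ 2) ^ m * g t) (Set.Icc (-1) 1) := by fun_prop
  refine le_trans (le_of_eq ?_) (eLpNorm_add_le (aesm_of_cont κ h1) (aesm_of_cont κ h2) (one_le_ofReal hp))
  congr 1; ext t; simp only [Pi.add_apply]; ring

theorem NN_bd {p κ : ℝ} {m : ℕ} {f g : ℝ → ℝ} (M : ℝ≥0) (h : ∀ t ∈ Set.Ioo (-1:ℝ) 1, |f t| ≤ M * |g t|) :
    NN p κ m f ≤ M * NN p κ m g := by
  unfold NN
  have := eLpNorm_le_mul_eLpNorm_of_ae_le_mul (μ := nuM κ) (f := fun t => (1 - t ^ 2) ^ m * f t)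
    (g := fun t => (1 - t ^ 2) ^ m * g t) (c := (M:ℝ)) (by
      filter_upwards [nu_ae κ] with t ht
      rw [norm_mul, norm_mul, Real.norm_eq_abs (f t), Real.norm_eq_abs (g t)]
      have := mul_le_mul_of_nonneg_left (h t ht) (norm_nonneg ((1 - t ^ 2) ^ m))
      linarith) (ENNReal.ofReal p)
  simpa using this

theorem NN_congr {p κ : ℝ} {m : ℕ} {f g : ℝ → ℝ} (h : ∀ t ∈ Set.Ioo (-1:ℝ) 1, f t = g t) :
    NN p κ m f = NN p κ m g := by
  unfold NN
  apply eLpNorm_congr_ae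
  filter_upwards [nu_ae κ] with t ht
  rw [h t ht]

theorem NN_succ (p κ : ℝ) (m : ℕ) (f : ℝ → ℝ) :
    NN p κ m (fun t => (1 - t ^ 2) * f t) = NN p κ (m + 1) f := by
  unfold NN
  congr 1; ext t; ring

theorem NN_succ_le (p κ : ℝ) (m : ℕ) (f : ℝ → ℝ) : NN p κ (m + 1) f ≤ NN p κ m f := by
  rw [← NN_succ]
  have := NN_bd (p := p) (κ := κ) (m := m) (f := fun t => (1 - t ^ 2) * f t) (g := f) 1 (fun t ht => by
    have := pos_of_Ioo ht
    rw [abs_mul, abs_of_pos this]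
    gcongr
    simp; positivity)
  simpa using this

theorem NN_const {p : ℝ} (hp : 1 < p) (κ : ℝ) (hκ : 0 < κ) (m : ℕ) : ∃ C : ℝ≥0, ∀ c : ℝ,
    NN p κ m (fun _ => c) ≤ C * ‖c‖ₑ := by
  have hfin : nuM κ Set.univ ^ (1 / p) ≠ ⊤ := ENNReal.rpow_ne_top_of_nonneg (by positivity) (nu_fin κ hκ).ne
  refine ⟨(nuM κ Set.univ ^ (1 / p)).toNNReal, fun c => ?_⟩
  rw [ENNReal.coe_toNNReal hfin]
  have h0 : NN p κ m (fun _ => c) ≤ NN p κ 0 (fun _ => c) := by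
    induction m with
    | zero => exact le_rfl
    | succ m ih => exact (NN_succ_le _ _ _ _).trans ih
  refine h0.trans ?_
  unfold NN
  simp only [pow_zero, one_mul]
  rw [eLpNorm_const' c (by simp; linarith) ENNReal.ofReal_ne_top, ENNReal.toReal_ofReal (by linarith), mul_comm]

theorem step {p : ℝ} (hp : 1 < p) (κ : ℝ) (hκ : 0 < κ) (m j : ℕ) : ∃ C : ℝ≥0, ∀ f : ℝ → ℝ, Sm (j + 1) f →
    NN p κ m (dW^[j] f) ≤ C * (NN p κ (m + 1) (dW^[j + 1] f) + NN p κ 0 f) := by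
  obtain ⟨C1, h1⟩ := H2 hp κ hκ m
  obtain ⟨C2, h2⟩ := H3 hp κ hκ (m + 1) j
  obtain ⟨C3, h3⟩ := NN_const hp κ hκ m
  refine ⟨C1 + C3 * C2, fun f hf => ?_⟩
  have hh : Sm 1 (dW^[j] f) := Sm.iter j (by rwa [add_comm])
  have hhc := hh.cont
  have e : NN p κ m (dW^[j] f) = NN p κ m (fun t => (dW^[j] f t - dW^[j] f 0) + dW^[j] f 0) := by
    congr 1; ext t; ring
  rw [e]
  refine (NN_add hp κ m (by fun_prop) (by fun_prop)).trans ?_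
  calc _ ≤ C1 * NN p κ (m + 1) (dW^[j + 1] f) + C3 * (C2 * (NN p κ (m + 1) (dW^[j + 1] f) + NN p κ 0 f)) := by
        gcongr
        · rw [Function.iterate_succ_apply']; exact h1 _ hh
        · refine (h3 _).trans ?_
          gcongr
          exact h2 f hf
    _ ≤ C1 * (NN p κ (m + 1) (dW^[j + 1] f) + NN p κ 0 f) + C3 * (C2 * (NN p κ (m + 1) (dW^[j + 1] f) + NN p κ 0 f)) := by
        gcongr
        exact le_self_add
    _ = _ := by push_cast; ring

theorem interm {p : ℝ} (hp : 1 < p) (κ : ℝ) (hκ : 0 < κ) (r : ℕ) (k : ℕ) : ∀ j, j + k = 2 * r →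
    ∃ C : ℝ≥0, ∀ f : ℝ → ℝ, Sm (2 * r) f →
    NN p κ (j - r) (dW^[j] f) ≤ C * (NN p κ r (dW^[2 * r] f) + NN p κ 0 f) := by
  induction k with
  | zero =>
    intro j hj
    refine ⟨1, fun f hf => ?_⟩
    obtain rfl : j = 2 * r := by omega
    rw [show 2 * r - r = r by omega]
    simp
  | succ k ih =>
    intro j hj
    obtain ⟨C, hC⟩ := ih (j + 1) (by omega)
    obtain ⟨C', hC'⟩ := step hp κ hκ (j - r) j
    refine ⟨C' * (C + 1), fun f hf => ?_⟩
    refine (hC' f (hf.mono (by omega))).trans ?_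
    rw [ENNReal.coe_mul, mul_assoc]
    gcongr
    rw [ENNReal.coe_add, add_mul, ENNReal.coe_one, one_mul]
    refine add_le_add ?_ le_add_self
    refine le_trans ?_ (hC f hf)
    by_cases h : r ≤ j
    · rw [show j + 1 - r = j - r + 1 by omega]
    · rw [show j + 1 - r = 0 by omega, show j - r = 0 by omega]
      exact NN_succ_le _ _ _ _

def Lop (κ : ℝ) (f : ℝ → ℝ) : ℝ → ℝ := fun t => (1 - t ^ 2) * dW (dW f) t - 2 * κ * t * dW f t

theorem Sm.hasDerivW {n : ℕ} {f : ℝ → ℝ} (h : Sm (n + 1) f) {x : ℝ} (hx : x ∈ Set.Icc (-1:ℝ) 1) :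
    HasDerivWithinAt f (_root_.dW f x) (Set.Icc (-1) 1) x := by
  have h1 : DifferentiableOn ℝ f (Set.Icc (-1) 1) := ContDiffOn.differentiableOn h (by simp)
  exact (h1 x hx).hasDerivWithinAt

theorem dW_eq {f : ℝ → ℝ} {x y : ℝ} (hx : x ∈ Set.Icc (-1:ℝ) 1) (h : HasDerivWithinAt f y (Set.Icc (-1) 1) x) :
    dW f x = y := h.derivWithin (uIcc1 x hx)

theorem dW_congr {f g : ℝ → ℝ} (h : Set.EqOn f g (Set.Icc (-1) 1)) : Set.EqOn (dW f) (dW g) (Set.Icc (-1) 1) :=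
  fun _ hx => derivWithin_congr h (h hx)

theorem Sm.Lop {n : ℕ} {f : ℝ → ℝ} (κ : ℝ) (h : Sm (n + 2) f) : Sm n (Lop κ f) := by
  have h1 : Sm (n + 1) (_root_.dW f) := Sm.dW h
  have h2 : Sm n (_root_.dW (_root_.dW f)) := Sm.dW h1
  have h1' : Sm n (_root_.dW f) := h1.mono (Nat.le_succ n)
  unfold Sm at *
  unfold _root_.Lop
  fun_prop

theorem Sm.Lops {n : ℕ} {f : ℝ → ℝ} (κ : ℝ) (j : ℕ) (h : Sm (n + 2 * j) f) : Sm n ((_root_.Lop κ)^[j] f) := by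
  induction j generalizing f with
  | zero => exact h
  | succ j ih =>
    rw [Function.iterate_succ_apply]
    exact ih (Sm.Lop κ (by rw [show n + 2 * j + 2 = n + 2 * (j + 1) by ring]; exact h))

theorem comm1 (κ c : ℝ) {f : ℝ → ℝ} (h : Sm 3 f) :
    Set.EqOn (dW (fun t => Lop κ f t - c * f t))
      (fun t => Lop (κ + 1) (dW f) t - (c + 2 * κ) * dW f t) (Set.Icc (-1) 1) := by
  intro x hx
  have h1 : Sm 2 (dW f) := Sm.dW h
  have h2 : Sm 1 (dW (dW f)) := Sm.dW h1
  apply dW_eq hx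
  have q1 : HasDerivWithinAt (fun t : ℝ => 1 - t ^ 2) (-(2 * x)) (Set.Icc (-1) 1) x := by
    have : HasDerivAt (fun t : ℝ => 1 - t ^ 2) (-(2 * x)) x := by
      simpa using (hasDerivAt_pow 2 x).const_sub 1
    exact this.hasDerivWithinAt
  have q2 : HasDerivWithinAt (fun t : ℝ => 2 * κ * t) (2 * κ) (Set.Icc (-1) 1) x := by
    simpa using ((hasDerivAt_id x).const_mul (2 * κ)).hasDerivWithinAt
  have := ((q1.mul (Sm.hasDerivW (n := 0) h2 hx)).sub (q2.mul (Sm.hasDerivW (n := 1) h1 hx))).sub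
    ((Sm.hasDerivW (n := 2) h hx).const_mul c)
  refine HasDerivWithinAt.congr_deriv this ?_
  unfold Lop
  ring

theorem commk (κ : ℝ) (k : ℕ) {f : ℝ → ℝ} (h : Sm (k + 2) f) :
    Set.EqOn (dW^[k] (Lop κ f)) (fun t => Lop (κ + k) (dW^[k] f) t - (k * (k + 2 * κ - 1)) * dW^[k] f t)
      (Set.Icc (-1) 1) := by
  induction k with
  | zero => intro x hx; simp
  | succ k ih =>
    have h1 := ih (h.mono (by omega))
    rw [Function.iterate_succ_apply']
    have h3 : Sm 3 (dW^[k] f) := Sm.iter k (by rw [show 3 + k = k + 1 + 2 by ring]; exact h)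
    refine (dW_congr h1).trans ((comm1 _ _ h3).trans ?_)
    intro x hx
    simp only [Function.iterate_succ_apply']
    push_cast
    rw [show κ + k + 1 = κ + (k + 1) by ring]
    ring

theorem lowA {p : ℝ} (hp : 1 < p) (κ : ℝ) (hκ : 0 < κ) (m : ℕ) : ∃ C : ℝ≥0, ∀ u : ℝ → ℝ, Sm 2 u →
    NN p κ m (dW u) ≤ C * NN p κ m (Lop (κ + 2 * m) u) := by
  obtain ⟨C, hC⟩ := H1 hp κ hκ m
  exact ⟨C, fun u hu => hC (dW u) (Sm.dW hu)⟩

theorem lowB {p : ℝ} (hp : 1 < p) (κ : ℝ) (hκ : 0 < κ) (m : ℕ) : ∃ C : ℝ≥0, ∀ u : ℝ → ℝ, Sm 2 u →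
    NN p κ (m + 1) (dW (dW u)) ≤ C * NN p κ m (Lop (κ + 2 * m) u) := by
  obtain ⟨C, hC⟩ := lowA hp κ hκ m
  refine ⟨1 + Real.toNNReal (2 * (κ + 2 * m)) * C, fun u hu => ?_⟩
  have h1 : Sm 1 (dW u) := Sm.dW hu
  have h1c := h1.cont
  have h2c := (Sm.Lop (n := 0) (κ + 2 * m) hu).cont
  rw [← NN_succ]
  have e : (fun t => (1 - t ^ 2) * dW (dW u) t) = fun t => Lop (κ + 2 * m) u t + 2 * (κ + 2 * m) * t * dW u t := by
    ext t; unfold Lop; ring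
  rw [e]
  refine (NN_add hp κ m h2c (by fun_prop)).trans ?_
  rw [ENNReal.coe_add, add_mul, ENNReal.coe_one, one_mul, ENNReal.coe_mul, mul_assoc]
  gcongr
  refine le_trans (NN_bd (g := dW u) (Real.toNNReal (2 * (κ + 2 * m))) ?_) (by gcongr; exact hC u hu)
  intro t ht
  have : (0:ℝ) ≤ 2 * (κ + 2 * m) := by positivity
  rw [Real.coe_toNNReal _ this, abs_mul, abs_mul, abs_of_nonneg this]
  have ht1 : |t| ≤ 1 := (abs_lt.2 ht).le
  have h5 := mul_le_mul_of_nonneg_left ht1 this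
  exact mul_le_mul_of_nonneg_right (by linarith) (abs_nonneg _)

theorem nu_mean (κ : ℝ) (hκ : 0 < κ) {f : ℝ → ℝ} (hf : Sm 2 f) : ∫ t, Lop κ f t ∂(nuM κ) = 0 := by
  unfold nuM
  rw [integral_withDensity_eq_integral_toReal_smul (by fun_prop)
    (Filter.Eventually.of_forall fun x => ENNReal.ofReal_lt_top)]
  have h1 : Sm 1 (dW f) := Sm.dW hf
  have hLc := (Sm.Lop (n := 0) κ hf).cont
  set G : ℝ → ℝ := fun t => (1 - t ^ 2) ^ κ * dW f t with hG
  set G' : ℝ → ℝ := fun t => (1 - t ^ 2) ^ (κ - 1) * Lop κ f t with hG'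
  have hGc : ContinuousOn G (Set.Icc (-1) 1) := by
    apply ContinuousOn.mul _ h1.cont
    exact ContinuousOn.rpow_const (by fun_prop) (fun _ _ => Or.inr hκ.le)
  have hGd : ∀ t ∈ Set.Ioo (-1:ℝ) 1, HasDerivAt G (G' t) t := by
    intro t ht
    have hpos := pos_of_Ioo ht
    have q1 : HasDerivAt (fun t : ℝ => 1 - t ^ 2) (-(2 * t)) t := by
      simpa using (hasDerivAt_pow 2 t).const_sub 1
    have h2 := (q1.rpow_const (p := κ) (Or.inl hpos.ne')).mul (Sm.hasDeriv (n := 0) h1 ht)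
    refine HasDerivAt.congr_deriv h2 ?_
    change _ = (1 - t ^ 2) ^ (κ - 1) * ((1 - t ^ 2) * dW (dW f) t - 2 * κ * t * dW f t)
    have : (1 - t ^ 2) ^ κ = (1 - t ^ 2) ^ (κ - 1) * (1 - t ^ 2) := by
      rw [Real.rpow_sub_one hpos.ne']; field_simp
    rw [this]; ring
  have hint : IntegrableOn G' (Set.Ioo (-1) 1) := by
    refine ⟨?_, ?_⟩
    · apply AEStronglyMeasurable.mul
      · have : Measurable fun t : ℝ => (1 - t ^ 2) ^ (κ - 1) := by fun_prop
        exact this.aestronglyMeasurable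
      · exact (hLc.mono Set.Ioo_subset_Icc_self).aestronglyMeasurable measurableSet_Ioo
    · obtain ⟨M, hM⟩ := (isCompact_Icc (a := (-1:ℝ)) (b := 1)).exists_bound_of_continuousOn hLc
      have hb : ∫⁻ t in Set.Ioo (-1:ℝ) 1, ‖G' t‖ₑ ≤ ∫⁻ t, ENNReal.ofReal M ∂(nuM κ) := by
        rw [nu_lint]
        apply setLIntegral_mono' measurableSet_Ioo
        intro t ht
        have hpos := pos_of_Ioo ht
        simp only [hG']
        rw [enorm_mul, Real.enorm_of_nonneg (r := (1 - t ^ 2) ^ (κ - 1)) (by positivity)]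
        gcongr
        rw [← ofReal_norm]
        exact ENNReal.ofReal_le_ofReal (hM t (Set.Ioo_subset_Icc_self ht))
      refine hb.trans_lt ?_
      rw [lintegral_const]
      exact ENNReal.mul_lt_top ENNReal.ofReal_lt_top (nu_fin κ hκ)
  have := intervalIntegral.integral_eq_sub_of_hasDerivAt_of_le (by norm_num) hGc hGd
    ((intervalIntegrable_iff_integrableOn_Ioo_of_le (by norm_num)).2 hint)
  rw [intervalIntegral.integral_of_le (by norm_num), integral_Ioc_eq_integral_Ioo] at this
  have e : ∫ x in Set.Ioo (-1:ℝ) 1, (ENNReal.ofReal ((1 - x ^ 2) ^ (κ - 1))).toReal • Lop κ f x =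
      ∫ x in Set.Ioo (-1:ℝ) 1, G' x := by
    apply setIntegral_congr_fun measurableSet_Ioo
    intro t ht
    have hpos := pos_of_Ioo ht
    simp only [hG', smul_eq_mul]
    rw [ENNReal.toReal_ofReal (by positivity)]
  rw [e, this]
  simp [hG, Real.zero_rpow hκ.ne']

theorem nu_pos (κ : ℝ) : nuM κ Set.univ ≠ 0 := by
  intro h
  have h2 : (1:ℝ≥0∞) ≤ 0 := by
    have h3 : ∫⁻ y in Set.Ioo (-1:ℝ) 1, ENNReal.ofReal ((1 - y ^ 2) ^ (κ - 1)) = 0 := by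
      have := nu_lint κ (fun _ => 1)
      simpa [h] using this.symm
    rw [lintegral_eq_zero_iff (by fun_prop)] at h3
    have h4 : ∀ᵐ y ∂(volume.restrict (Set.Ioo (-1:ℝ) 1)), False := by
      filter_upwards [h3, ae_restrict_mem measurableSet_Ioo] with y hy hy2
      have := pos_of_Ioo hy2
      simp only [Pi.zero_apply, ENNReal.ofReal_eq_zero] at hy
      have : 0 < (1 - y ^ 2) ^ (κ - 1) := by positivity
      linarith
    rw [Filter.eventually_false_iff_eq_bot, ae_eq_bot, Measure.restrict_eq_zero, Real.volume_Ioo] at h4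
    norm_num at h4
  simp at h2

theorem poincare {p : ℝ} (hp : 1 < p) (κ : ℝ) (hκ : 0 < κ) : ∃ C : ℝ≥0, ∀ f : ℝ → ℝ, Sm 1 f →
    ∫ t, f t ∂(nuM κ) = 0 → NN p κ 0 f ≤ C * NN p κ 0 (dW f) := by
  obtain ⟨C1, h1⟩ := H2 hp κ hκ 0
  obtain ⟨C3, h3⟩ := NN_const hp κ hκ 0
  have : Fact (0 < κ) := ⟨hκ⟩
  set V := nuM κ Set.univ with hV
  have hVt : V ≠ ⊤ := (nu_fin κ hκ).ne
  have hV0 : V ≠ 0 := nu_pos κ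
  set M := V ^ (1 - 1 / p) with hM
  have hMt : M ≠ ⊤ := ENNReal.rpow_ne_top_of_nonneg (by
    have : 1 / p ≤ 1 := by rw [div_le_one (by linarith)]; exact hp.le
    linarith) hVt
  have hWt : V⁻¹ * M ≠ ⊤ := ENNReal.mul_ne_top (ENNReal.inv_ne_top.2 hV0) hMt
  refine ⟨C1 + C3 * ((V⁻¹ * M).toNNReal * C1), fun f hf hmean => ?_⟩
  have hfc := hf.cont
  have hdc : ContinuousOn (fun t => f t - f 0) (Set.Icc (-1) 1) := by fun_prop
  have hE : NN p κ 0 (fun t => f t - f 0) ≤ C1 * NN p κ 0 (dW f) := by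
    refine (h1 f hf).trans ?_
    gcongr
    exact NN_succ_le _ _ _ _
  have hint : Integrable f (nuM κ) := by
    obtain ⟨B, hB⟩ := (isCompact_Icc (a := (-1:ℝ)) (b := 1)).exists_bound_of_continuousOn hfc
    refine Integrable.of_bound (aesm_of_cont κ hfc) B ?_
    filter_upwards [nu_ae κ] with t ht
    exact hB t (Set.Ioo_subset_Icc_self ht)
  have h0 : ‖f 0‖ₑ ≤ V⁻¹ * M * NN p κ 0 (fun t => f t - f 0) := by
    have e : ∫ t, (f t - f 0) ∂(nuM κ) = - (V.toReal * f 0) := by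
      rw [integral_sub hint (integrable_const _), hmean, integral_const, zero_sub, smul_eq_mul]
      rfl
    have hle : V * ‖f 0‖ₑ ≤ NN p κ 0 (fun t => f t - f 0) * M := by
      calc V * ‖f 0‖ₑ = ‖∫ t, (f t - f 0) ∂(nuM κ)‖ₑ := by
            rw [e, enorm_neg, enorm_mul, Real.enorm_of_nonneg ENNReal.toReal_nonneg, ENNReal.ofReal_toReal hVt]
        _ ≤ ∫⁻ t, ‖f t - f 0‖ₑ ∂(nuM κ) := enorm_integral_le_lintegral_enorm _
        _ = eLpNorm (fun t => f t - f 0) 1 (nuM κ) := by rw [eLpNorm_one_eq_lintegral_enorm]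
        _ ≤ _ := by
          have := eLpNorm_le_eLpNorm_mul_rpow_measure_univ (p := 1) (q := ENNReal.ofReal p)
            (one_le_ofReal hp) (aesm_of_cont κ hdc)
          simpa [NN, hM, hV, ENNReal.toReal_ofReal (by linarith : 0 ≤ p)] using this
    calc ‖f 0‖ₑ = V⁻¹ * (V * ‖f 0‖ₑ) := by rw [← mul_assoc, ENNReal.inv_mul_cancel hV0 hVt, one_mul]
      _ ≤ V⁻¹ * (NN p κ 0 (fun t => f t - f 0) * M) := by gcongr
      _ = _ := by ring
  have e : NN p κ 0 f = NN p κ 0 (fun t => (f t - f 0) + f 0) := by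
    congr 1; ext t; ring
  rw [e]
  refine (NN_add hp κ 0 hdc (by fun_prop)).trans ?_
  calc _ ≤ C1 * NN p κ 0 (dW f) + C3 * (V⁻¹ * M * (C1 * NN p κ 0 (dW f))) := by
        gcongr
        refine (h3 _).trans ?_
        gcongr
        refine h0.trans ?_
        gcongr
    _ = _ := by
        rw [ENNReal.coe_add, ENNReal.coe_mul, ENNReal.coe_mul, ENNReal.coe_toNNReal hWt]; ring

theorem NN_smul {p κ : ℝ} {m : ℕ} (c : ℝ) (g : ℝ → ℝ) :
    NN p κ m (fun t => c * g t) ≤ (Real.toNNReal |c| : ℝ≥0) * NN p κ m g := by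
  apply NN_bd
  intro t _
  rw [Real.coe_toNNReal _ (abs_nonneg c), abs_mul]

theorem NN_tmul {p κ : ℝ} {m : ℕ} (c : ℝ) (g : ℝ → ℝ) :
    NN p κ m (fun t => c * t * g t) ≤ (Real.toNNReal |c| : ℝ≥0) * NN p κ m g := by
  apply NN_bd
  intro t ht
  rw [Real.coe_toNNReal _ (abs_nonneg c), abs_mul, abs_mul]
  have ht1 : |t| ≤ 1 := (abs_lt.2 ht).le
  have h5 := mul_le_mul_of_nonneg_left ht1 (abs_nonneg c)
  exact mul_le_mul_of_nonneg_right (by linarith) (abs_nonneg _)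

theorem Lop_up {p : ℝ} (hp : 1 < p) (κ a : ℝ) (m : ℕ) {u : ℝ → ℝ} (hu : Sm 2 u) :
    NN p κ m (Lop a u) ≤ NN p κ (m + 1) (dW (dW u)) + (Real.toNNReal |-(2 * a)| : ℝ≥0) * NN p κ m (dW u) := by
  have h1 : Sm 1 (dW u) := Sm.dW hu
  have h2 : Sm 0 (dW (dW u)) := Sm.dW h1
  have h1c := h1.cont
  have h2c := h2.cont
  have e : Lop a u = fun t => (1 - t ^ 2) * dW (dW u) t + (-(2 * a)) * t * dW u t := by
    ext t; unfold Lop; ring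
  rw [e, ← NN_succ]
  refine (NN_add hp κ m (by fun_prop) (by fun_prop)).trans ?_
  gcongr
  exact NN_tmul _ _

theorem lower1D {p : ℝ} (hp : 1 < p) (κ : ℝ) (hκ : 0 < κ) (r : ℕ) : ∃ C : ℝ≥0, ∀ f : ℝ → ℝ, Sm (2 * r) f →
    NN p κ r (dW^[2 * r] f) ≤ C * NN p κ 0 ((Lop κ)^[r] f) := by
  induction r with
  | zero => exact ⟨1, fun f _ => by simp⟩
  | succ r ih =>
    obtain ⟨C0, h0⟩ := ih
    obtain ⟨C1, h1⟩ := lowB hp κ hκ r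
    obtain ⟨C2, h2⟩ := lowA hp κ hκ 0
    obtain ⟨C3, h3⟩ := poincare hp κ hκ
    set lam : ℝ := ((2 * r : ℕ) : ℝ) * ((2 * r : ℕ) + 2 * κ - 1) with hlam
    refine ⟨C1 * (C0 + Real.toNNReal |lam| * (C0 * (C3 * C2))), fun f hf => ?_⟩
    have hfa : Sm (2 + 2 * r) f := hf.mono (by omega)
    have hu : Sm 2 (dW^[2 * r] f) := Sm.iter (2 * r) hfa
    have huc := hu.cont
    have hLf : Sm (2 * r) (Lop κ f) := Sm.Lop κ (hf.mono (by omega))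
    have hLc := (Sm.iter (n := 0) (2 * r) (by simpa using hLf)).cont
    have hk := commk κ (2 * r) (f := f) (hf.mono (by omega))
    have e : NN p κ r (Lop (κ + 2 * r) (dW^[2 * r] f)) =
        NN p κ r (fun t => dW^[2 * r] (Lop κ f) t + lam * dW^[2 * r] f t) := by
      apply NN_congr
      intro t ht
      rw [hk (Set.Ioo_subset_Icc_self ht)]
      simp only [hlam]
      push_cast
      ring
    have hA : NN p κ r (Lop (κ + 2 * r) (dW^[2 * r] f)) ≤ C0 * NN p κ 0 ((Lop κ)^[r + 1] f) +
        (Real.toNNReal |lam| : ℝ≥0) * NN p κ r (dW^[2 * r] f) := by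
      rw [e]
      refine (NN_add hp κ r hLc (by fun_prop)).trans ?_
      gcongr
      · exact h0 _ hLf
      · exact NN_smul _ _
    have hB : (Real.toNNReal |lam| : ℝ≥0) * NN p κ r (dW^[2 * r] f) ≤
        (Real.toNNReal |lam| : ℝ≥0) * (C0 * (C3 * (C2 * NN p κ 0 ((Lop κ)^[r + 1] f)))) := by
      rcases Nat.eq_zero_or_pos r with hr | hr
      · have : lam = 0 := by rw [hlam, hr]; simp
        simp [this]
      · gcongr
        refine (h0 f (hf.mono (by omega))).trans ?_
        gcongr
        have hs : Sm 2 ((Lop κ)^[r] f) := Sm.Lops κ r (hf.mono (by omega))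
        refine (h3 _ (hs.mono (by omega)) ?_).trans ?_
        · obtain ⟨q, rfl⟩ : ∃ q, r = q + 1 := ⟨r - 1, by omega⟩
          rw [Function.iterate_succ_apply']
          exact nu_mean κ hκ (Sm.Lops κ q (hf.mono (by omega)))
        · gcongr
          rw [Function.iterate_succ_apply']
          simpa using h2 _ hs
    have hC := h1 _ hu
    rw [show 2 * (r + 1) = 2 * r + 1 + 1 by ring, Function.iterate_succ_apply', Function.iterate_succ_apply']
    refine hC.trans ?_
    calc _ ≤ C1 * (C0 * NN p κ 0 ((Lop κ)^[r + 1] f) +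
          (Real.toNNReal |lam| : ℝ≥0) * (C0 * (C3 * (C2 * NN p κ 0 ((Lop κ)^[r + 1] f))))) := by
          gcongr
          exact hA.trans (by gcongr)
      _ = _ := by push_cast; ring

theorem NN_anti (p κ : ℝ) {m k : ℕ} (h : m ≤ k) (f : ℝ → ℝ) : NN p κ k f ≤ NN p κ m f := by
  induction k, h using Nat.le_induction with
  | base => exact le_rfl
  | succ k _ ih => exact (NN_succ_le _ _ _ _).trans ih

theorem upper1D {p : ℝ} (hp : 1 < p) (κ : ℝ) (hκ : 0 < κ) (r : ℕ) : ∃ C : ℝ≥0, ∀ f : ℝ → ℝ, Sm (2 * r) f →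
    NN p κ 0 ((Lop κ)^[r] f) ≤ C * (NN p κ r (dW^[2 * r] f) + NN p κ 0 f) := by
  induction r with
  | zero => exact ⟨1, fun f _ => by simp⟩
  | succ r ih =>
    obtain ⟨C0, h0⟩ := ih
    obtain ⟨A1, a1⟩ := interm hp κ hκ (r + 1) 1 (2 * r + 1) (by ring)
    obtain ⟨A2, a2⟩ := interm hp κ hκ (r + 1) 2 (2 * r) (by ring)
    obtain ⟨A3, a3⟩ := interm hp κ hκ (r + 1) (2 * r) 2 (by ring)
    obtain ⟨A4, a4⟩ := interm hp κ hκ (r + 1) (2 * r + 1) 1 (by ring)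
    set lam : ℝ := -(((2 * r : ℕ) : ℝ) * ((2 * r : ℕ) + 2 * κ - 1)) with hlam
    set l1 := Real.toNNReal |-(2 * (κ + (2 * r : ℕ)))| with hl1
    set l2 := Real.toNNReal |lam| with hl2
    set l3 := Real.toNNReal |-(2 * κ)| with hl3
    refine ⟨C0 * (1 + l1 * A1 + l2 * A2 + (A3 + l3 * A4)), fun f hf => ?_⟩
    have hfa : Sm (2 + 2 * r) f := hf.mono (by omega)
    have hu : Sm 2 (dW^[2 * r] f) := Sm.iter (2 * r) hfa
    have huc := hu.cont
    have hf2 : Sm 2 f := hf.mono (by omega)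
    have hLf : Sm (2 * r) (Lop κ f) := Sm.Lop κ (hf.mono (by omega))
    have hLc := (Sm.Lop (n := 0) (κ + (2 * r : ℕ)) hu).cont
    have hk := commk κ (2 * r) (f := f) (hf.mono (by omega))
    set X := NN p κ (r + 1) (dW^[2 * (r + 1)] f) + NN p κ 0 f with hX
    have hA : NN p κ r (dW^[2 * r] (Lop κ f)) ≤ (X + l1 * (A1 * X)) + l2 * (A2 * X) := by
      have e : NN p κ r (dW^[2 * r] (Lop κ f)) =
          NN p κ r (fun t => Lop (κ + (2 * r : ℕ)) (dW^[2 * r] f) t + lam * dW^[2 * r] f t) := by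
        apply NN_congr
        intro t ht
        rw [hk (Set.Ioo_subset_Icc_self ht)]
        simp only [hlam]
        ring
      rw [e]
      refine (NN_add hp κ r hLc (by fun_prop)).trans ?_
      gcongr
      · refine (Lop_up hp κ _ r hu).trans ?_
        rw [← Function.iterate_succ_apply' dW, ← Function.iterate_succ_apply' dW]
        gcongr
        · exact le_self_add
        · have := a1 f hf
          rwa [show 2 * r + 1 - (r + 1) = r by omega] at this
      · refine (NN_smul _ _).trans ?_
        gcongr
        exact (NN_anti _ _ (by omega) _).trans (a2 f hf)
    have hB : NN p κ 0 (Lop κ f) ≤ A3 * X + l3 * (A4 * X) := by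
      refine (Lop_up hp κ _ 0 hf2).trans ?_
      gcongr
      · exact (NN_anti _ _ (by omega) _).trans (a3 f hf)
      · have := a4 f hf
        rwa [show 1 - (r + 1) = 0 by omega] at this
    rw [Function.iterate_succ_apply]
    refine (h0 _ hLf).trans ?_
    calc _ ≤ C0 * ((X + l1 * (A1 * X)) + l2 * (A2 * X) + (A3 * X + l3 * (A4 * X))) := by gcongr
      _ = _ := by push_cast; ring

abbrev EE (d : ℕ) := EuclideanSpace ℝ (Fin d)

abbrev eb {d : ℕ} (i : Fin d) : EE d := EuclideanSpace.single i 1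

theorem pder_cd {d n : ℕ} (i : Fin d) {g : EE d → ℝ} (hg : ContDiffOn ℝ ((n + 1 : ℕ) : WithTop ℕ∞) g (ball 0 1)) :
    ContDiffOn ℝ n (pder i g) (ball 0 1) := by
  unfold pder
  have : ContDiffOn ℝ n (fderiv ℝ g) (ball 0 1) := hg.fderiv_of_isOpen isOpen_ball (by push_cast; exact le_rfl)
  fun_prop

theorem pder_iter_cd {d n : ℕ} (i : Fin d) (j : ℕ) {g : EE d → ℝ}
    (hg : ContDiffOn ℝ ((n + j : ℕ) : WithTop ℕ∞) g (ball 0 1)) :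
    ContDiffOn ℝ n ((pder i)^[j] g) (ball 0 1) := by
  induction j generalizing g with
  | zero => exact hg
  | succ j ih =>
    rw [Function.iterate_succ_apply]
    exact ih (pder_cd i hg)

theorem hasD {d : ℕ} (_i : Fin d) {g : EE d → ℝ} (hg : ContDiffOn ℝ 1 g (ball 0 1)) {x : EE d} (hx : x ∈ ball (0 : EE d) 1) :
    HasFDerivAt g (fderiv ℝ g x) x :=
  ((hg.differentiableOn (by simp)).differentiableAt (isOpen_ball.mem_nhds hx)).hasFDerivAt

theorem one_sub_pos {d : ℕ} {x : EE d} (hx : x ∈ ball (0 : EE d) 1) : 0 < 1 - ‖x‖ ^ 2 := by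
  have : ‖x‖ < 1 := by simpa using hx
  nlinarith [norm_nonneg x]

theorem Dii_eq {d : ℕ} (μ : ℝ) (i : Fin d) {g : EE d → ℝ} (hg : ContDiffOn ℝ 2 g (ball 0 1)) {x : EE d}
    (hx : x ∈ ball (0 : EE d) 1) :
    DiiOp μ i g x = (1 - ‖x‖ ^ 2) * pder i (pder i g) x - (2 * μ + 1) * x i * pder i g x := by
  have hpos := one_sub_pos hx
  have h1 : ContDiffOn ℝ 1 (pder i g) (ball 0 1) := by
    have := pder_cd (n := 1) i (g := g) (by exact_mod_cast hg)
    exact_mod_cast this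
  have hd := hasD i h1 hx
  have q : HasFDerivAt (fun y : EE d => 1 - ‖y‖ ^ 2) (-(2 • (innerSL ℝ x))) x :=
    (hasStrictFDerivAt_norm_sq x).hasFDerivAt.const_sub 1
  have w := q.rpow_const (p := μ - 1 / 2) (Or.inl hpos.ne')
  have t := ((q.mul w).mul hd).fderiv
  unfold DiiOp
  conv_lhs => rw [pder]
  erw [t]
  have ein : inner ℝ x (EuclideanSpace.single i (1:ℝ)) = x i := by
    rw [EuclideanSpace.inner_single_right]; simp
  simp only [_root_.add_apply, _root_.smul_apply, _root_.neg_apply, innerSL_apply_apply, ein, Pi.mul_apply, smul_eq_mul, nsmul_eq_mul]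
  rw [Real.rpow_sub_one hpos.ne']
  have hw : (1 - ‖x‖ ^ 2) ^ (μ - 1 / 2) ≠ 0 := by positivity
  change _ = (1 - ‖x‖ ^ 2) * fderiv ℝ (pder i g) x (EuclideanSpace.single i 1) - _
  push_cast
  field_simp
  ring

theorem Dii_cd {d n : ℕ} (μ : ℝ) (i : Fin d) {g : EE d → ℝ}
    (hg : ContDiffOn ℝ ((n + 2 : ℕ) : WithTop ℕ∞) g (ball 0 1)) :
    ContDiffOn ℝ n (DiiOp μ i g) (ball 0 1) := by
  have hg1 : ContDiffOn ℝ ((n + 1 : ℕ) : WithTop ℕ∞) (pder i g) (ball 0 1) := pder_cd i hg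
  have hg2 : ContDiffOn ℝ n (pder i (pder i g)) (ball 0 1) := pder_cd i hg1
  have hg1' : ContDiffOn ℝ n (pder i g) (ball 0 1) := hg1.of_le (by exact_mod_cast Nat.le_succ n)
  have h2 : ContDiffOn ℝ 2 g (ball 0 1) := hg.of_le (by exact_mod_cast Nat.le_add_left 2 n)
  have : ContDiffOn ℝ n (fun x : EE d => (1 - ‖x‖ ^ 2) * pder i (pder i g) x - (2 * μ + 1) * x i * pder i g x)
      (ball 0 1) := by
    have a1 : ContDiff ℝ n (fun x : EE d => ‖x‖ ^ 2) := contDiff_norm_sq ℝ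
    have a2 : ContDiff ℝ n (fun x : EE d => x i) := by fun_prop
    exact ((contDiff_const.sub a1).contDiffOn.mul hg2).sub (((contDiff_const.mul a2).contDiffOn).mul hg1')
  exact this.congr fun x hx => Dii_eq μ i h2 hx

theorem Dii_iter_cd {d n : ℕ} (μ : ℝ) (i : Fin d) (j : ℕ) {g : EE d → ℝ}
    (hg : ContDiffOn ℝ ((n + 2 * j : ℕ) : WithTop ℕ∞) g (ball 0 1)) :
    ContDiffOn ℝ n ((DiiOp μ i)^[j] g) (ball 0 1) := by
  induction j generalizing g with
  | zero => exact hg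
  | succ j ih =>
    rw [Function.iterate_succ_apply]
    exact ih (Dii_cd μ i (by rwa [show n + 2 * j + 2 = n + 2 * (j + 1) by ring]))

/-- A line through `z` in direction `e_i`. -/
def gam {d : ℕ} (i : Fin d) (z : EE d) (t : ℝ) : EE d := z + (Real.sqrt (1 - ‖z‖ ^ 2) * t) • eb i

theorem norm_add_sq' {d : ℕ} (i : Fin d) {z : EE d} (hz : z i = 0) (s : ℝ) :
    ‖z + s • eb i‖ ^ 2 = ‖z‖ ^ 2 + s ^ 2 := by
  rw [norm_add_sq_real, inner_smul_right, norm_smul]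
  have ein : inner ℝ z (eb i) = z i := by
    rw [EuclideanSpace.inner_single_right]; simp
  rw [ein, hz]
  simp

theorem gam_norm {d : ℕ} (i : Fin d) {z : EE d} (hz : z i = 0) (hz1 : ‖z‖ < 1) (t : ℝ) :
    1 - ‖gam i z t‖ ^ 2 = (1 - ‖z‖ ^ 2) * (1 - t ^ 2) := by
  unfold gam
  rw [norm_add_sq' i hz, mul_pow, Real.sq_sqrt (by nlinarith [norm_nonneg z])]
  ring

theorem gam_ball {d : ℕ} (i : Fin d) {z : EE d} (hz : z i = 0) (hz1 : ‖z‖ < 1) {t : ℝ} :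
    gam i z t ∈ ball (0 : EE d) 1 ↔ t ∈ Set.Ioo (-1:ℝ) 1 := by
  have h := gam_norm i hz hz1 t
  have h0 : 0 < 1 - ‖z‖ ^ 2 := by nlinarith [norm_nonneg z]
  rw [mem_ball_zero_iff, ← sq_lt_one_iff₀ (norm_nonneg _), Set.mem_Ioo, ← abs_lt, ← sq_lt_one_iff_abs_lt_one]
  constructor
  · intro h1
    have : 0 < 1 - t ^ 2 := pos_of_mul_pos_right (by rw [← h]; linarith) h0.le
    linarith
  · intro h1
    have : 0 < (1 - ‖z‖ ^ 2) * (1 - t ^ 2) := mul_pos h0 (by linarith)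
    linarith

theorem gam_cball {d : ℕ} (i : Fin d) {z : EE d} (hz : z i = 0) (hz1 : ‖z‖ < 1) {t : ℝ} (ht : t ∈ Set.Icc (-1:ℝ) 1) :
    gam i z t ∈ closedBall (0 : EE d) 1 := by
  have h := gam_norm i hz hz1 t
  have h0 : 0 < 1 - ‖z‖ ^ 2 := by nlinarith [norm_nonneg z]
  rw [mem_closedBall_zero_iff, ← sq_le_one_iff₀ (norm_nonneg _)]
  have : 0 ≤ (1 - ‖z‖ ^ 2) * (1 - t ^ 2) := mul_nonneg h0.le (by nlinarith [ht.1, ht.2])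
  linarith

theorem gam_deriv {d : ℕ} (i : Fin d) {z : EE d} (hz : z i = 0) (hz1 : ‖z‖ < 1) {h : EE d → ℝ}
    (hh : ContDiffOn ℝ 1 h (ball 0 1)) {F : ℝ → ℝ} (hF : ∀ t ∈ Set.Ioo (-1:ℝ) 1, F t = h (gam i z t)) :
    ∀ t ∈ Set.Ioo (-1:ℝ) 1, dW F t = Real.sqrt (1 - ‖z‖ ^ 2) * pder i h (gam i z t) := by
  intro t ht
  have hg : HasDerivAt (gam i z) (Real.sqrt (1 - ‖z‖ ^ 2) • eb i) t := by
    unfold gam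
    have := (((hasDerivAt_id t).const_mul (Real.sqrt (1 - ‖z‖ ^ 2))).smul_const (eb i)).const_add z
    simpa using this
  have h1 := (hasD i hh ((gam_ball i hz hz1).2 ht)).comp_hasDerivAt t hg
  have h2 : HasDerivAt F (fderiv ℝ h (gam i z t) (Real.sqrt (1 - ‖z‖ ^ 2) • eb i)) t := by
    refine h1.congr_of_eventuallyEq ?_
    filter_upwards [isOpen_Ioo.mem_nhds ht] with s hs using hF s hs
  rw [dW_eq (Set.Ioo_subset_Icc_self ht) h2.hasDerivWithinAt, map_smul]
  rfl

theorem gam_iter {d : ℕ} (i : Fin d) {z : EE d} (hz : z i = 0) (hz1 : ‖z‖ < 1) (j : ℕ) {g : EE d → ℝ}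
    (hg : ContDiffOn ℝ j g (ball 0 1)) :
    ∀ t ∈ Set.Ioo (-1:ℝ) 1, dW^[j] (fun t => g (gam i z t)) t =
      Real.sqrt (1 - ‖z‖ ^ 2) ^ j * (pder i)^[j] g (gam i z t) := by
  induction j with
  | zero => intro t _; simp
  | succ j ih =>
    intro t ht
    have hgj : ContDiffOn ℝ 1 ((pder i)^[j] g) (ball 0 1) := by
      have := pder_iter_cd (n := 1) i j (g := g) (by rwa [add_comm])
      exact_mod_cast this
    have hih := ih (hg.of_le (by exact_mod_cast Nat.le_succ j))
    have hc : ContDiffOn ℝ 1 (fun x => Real.sqrt (1 - ‖z‖ ^ 2) ^ j * (pder i)^[j] g x) (ball 0 1) := by fun_prop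
    rw [Function.iterate_succ_apply', gam_deriv i hz hz1 hc hih t ht, Function.iterate_succ_apply']
    have hx := (gam_ball i hz hz1).2 ht
    have := ((hasD i hgj hx).const_mul (Real.sqrt (1 - ‖z‖ ^ 2) ^ j)).fderiv
    have e : pder i (fun x => Real.sqrt (1 - ‖z‖ ^ 2) ^ j * (pder i)^[j] g x) (gam i z t) =
        Real.sqrt (1 - ‖z‖ ^ 2) ^ j * pder i ((pder i)^[j] g) (gam i z t) := by
      conv_lhs => rw [pder]
      rw [this]; rfl
    rw [e]; ring

theorem gam_Lop {d : ℕ} (μ : ℝ) (i : Fin d) {z : EE d} (hz : z i = 0) (hz1 : ‖z‖ < 1) {h : EE d → ℝ}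
    (hh : ContDiffOn ℝ 2 h (ball 0 1)) {F : ℝ → ℝ} (hF : ∀ t ∈ Set.Ioo (-1:ℝ) 1, F t = h (gam i z t)) :
    ∀ t ∈ Set.Ioo (-1:ℝ) 1, Lop (μ + 1 / 2) F t = DiiOp μ i h (gam i z t) := by
  intro t ht
  have hx := (gam_ball i hz hz1).2 ht
  have h1 : ContDiffOn ℝ 1 (pder i h) (ball 0 1) := by
    have := pder_cd (n := 1) i (g := h) (by exact_mod_cast hh)
    exact_mod_cast this
  have a1 := gam_deriv i hz hz1 (hh.of_le (by norm_num)) hF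
  have hc : ContDiffOn ℝ 1 (fun x => Real.sqrt (1 - ‖z‖ ^ 2) * pder i h x) (ball 0 1) := by fun_prop
  have a2 := gam_deriv i hz hz1 hc a1 t ht
  have := ((hasD i h1 hx).const_mul (Real.sqrt (1 - ‖z‖ ^ 2))).fderiv
  have e : pder i (fun x => Real.sqrt (1 - ‖z‖ ^ 2) * pder i h x) (gam i z t) =
      Real.sqrt (1 - ‖z‖ ^ 2) * pder i (pder i h) (gam i z t) := by
    conv_lhs => rw [pder]
    rw [this]; rfl
  rw [e] at a2
  have h0 : 0 < 1 - ‖z‖ ^ 2 := by nlinarith [norm_nonneg z]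
  rw [Dii_eq μ i hh hx, gam_norm i hz hz1, Lop, a2, a1 t ht]
  have ei : gam i z t i = Real.sqrt (1 - ‖z‖ ^ 2) * t := by simp [gam, hz]
  rw [ei, ← mul_assoc (Real.sqrt _) (Real.sqrt _), Real.mul_self_sqrt h0.le]
  ring

theorem gam_Lops {d : ℕ} (μ : ℝ) (i : Fin d) {z : EE d} (hz : z i = 0) (hz1 : ‖z‖ < 1) (j : ℕ) {g : EE d → ℝ}
    (hg : ContDiffOn ℝ ((2 * j : ℕ) : WithTop ℕ∞) g (ball 0 1)) :
    ∀ t ∈ Set.Ioo (-1:ℝ) 1, (Lop (μ + 1 / 2))^[j] (fun t => g (gam i z t)) t = (DiiOp μ i)^[j] g (gam i z t) := by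
  induction j with
  | zero => intro t _; simp
  | succ j ih =>
    intro t ht
    have hgj : ContDiffOn ℝ 2 ((DiiOp μ i)^[j] g) (ball 0 1) := by
      have := Dii_iter_cd (n := 2) μ i j (g := g) (by rwa [show 2 + 2 * j = 2 * (j + 1) by ring])
      exact_mod_cast this
    have hih := ih (hg.of_le (by exact_mod_cast (by omega : 2 * j ≤ 2 * (j + 1))))
    rw [Function.iterate_succ_apply', Function.iterate_succ_apply']
    exact gam_Lop μ i hz hz1 hgj hih t ht

theorem gam_Sm {d n : ℕ} (i : Fin d) {z : EE d} (hz : z i = 0) (hz1 : ‖z‖ < 1) {g : EE d → ℝ}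
    (hg : ContDiffOn ℝ n g (closedBall 0 1)) : Sm n (fun t => g (gam i z t)) := by
  have : ContDiff ℝ n (gam i z) := by unfold gam; fun_prop
  exact hg.comp this.contDiffOn fun t ht => gam_cball i hz hz1 ht

/-- Integrand on the open ball. -/
def PP {d : ℕ} (p μ : ℝ) (h : EE d → ℝ) : EE d → ℝ≥0∞ :=
  (ball (0 : EE d) 1).indicator fun x => ENNReal.ofReal ((1 - ‖x‖ ^ 2) ^ (μ - 1 / 2)) * ‖h x‖ₑ ^ p

theorem PP_meas {d : ℕ} (p μ : ℝ) {h : EE d → ℝ} (hh : ContinuousOn h (ball 0 1)) : Measurable (PP p μ h) := by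
  classical
  have h1 : Measurable ((ball (0 : EE d) 1).indicator h) := by
    have : Set.indicator (ball (0 : EE d) 1) h = Set.piecewise (ball (0 : EE d) 1) h 0 := by
      rw [Set.piecewise_eq_indicator]
    rw [this]
    exact hh.measurable_piecewise continuousOn_const measurableSet_ball
  have e : PP p μ h = (ball (0 : EE d) 1).indicator fun x => ENNReal.ofReal ((1 - ‖x‖ ^ 2) ^ (μ - 1 / 2)) *
      ‖(ball (0 : EE d) 1).indicator h x‖ₑ ^ p := by
    ext x
    by_cases hx : x ∈ ball (0 : EE d) 1
    · simp only [PP, Set.indicator_of_mem hx]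
    · simp only [PP, Set.indicator_of_notMem hx]
  rw [e]
  apply Measurable.indicator _ measurableSet_ball
  fun_prop

theorem eLp_PP {d : ℕ} {p : ℝ} (hp : 1 < p) (μ : ℝ) (h : EE d → ℝ) :
    eLpNorm h (ENNReal.ofReal p) (ballMeasure d μ) = (∫⁻ x, PP p μ h x) ^ (1 / p) := by
  have h0 : ENNReal.ofReal p ≠ 0 := by simp; linarith
  rw [eLpNorm_eq_lintegral_rpow_enorm_toReal h0 ENNReal.ofReal_ne_top, ENNReal.toReal_ofReal (by linarith)]
  congr 1
  unfold ballMeasure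
  rw [lintegral_withDensity_eq_lintegral_mul_non_measurable _ (by fun_prop)
    (Filter.Eventually.of_forall fun x => ENNReal.ofReal_lt_top)]
  unfold PP
  rw [lintegral_indicator measurableSet_ball]
  have : volume.restrict (closedBall (0 : EE d) 1) = volume.restrict (ball (0 : EE d) 1) := by
    apply Measure.restrict_congr_set
    exact (ae_eq_set.2 ⟨by
      rw [closedBall_sdiff_ball]; exact Measure.addHaar_sphere_of_ne_zero _ _ one_ne_zero,
      by rw [Set.sdiff_eq_empty.2 ball_subset_closedBall]; simp⟩)
  rw [this]
  rfl

/-- Embedding of the hyperplane. -/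
def zz {n : ℕ} (i : Fin (n + 1)) (y : Fin n → ℝ) : EE (n + 1) := WithLp.toLp 2 (i.insertNth 0 y)

theorem zz_i {n : ℕ} (i : Fin (n + 1)) (y : Fin n → ℝ) : zz i y i = 0 := by simp [zz]

theorem fub {n : ℕ} (i : Fin (n + 1)) {F : EE (n + 1) → ℝ≥0∞} (hF : Measurable F) :
    ∫⁻ x, F x = ∫⁻ y : Fin n → ℝ, ∫⁻ s : ℝ, F (zz i y + s • eb i) := by
  have h1 := (PiLp.volume_preserving_toLp (Fin (n + 1))).lintegral_comp hF
  have hF2 : Measurable fun a : Fin (n + 1) → ℝ => F (WithLp.toLp 2 a) :=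
    hF.comp (PiLp.volume_preserving_toLp (Fin (n + 1))).measurable
  have h2 := (volume_preserving_piFinSuccAbove (fun _ : Fin (n + 1) => ℝ) i).symm.lintegral_comp hF2
  rw [← h1, ← h2]
  have hm : Measurable fun a : ℝ × (Fin n → ℝ) =>
      F (WithLp.toLp 2 ((MeasurableEquiv.piFinSuccAbove (fun _ : Fin (n + 1) => ℝ) i).symm a)) :=
    hF2.comp (MeasurableEquiv.measurable _)
  rw [Measure.volume_eq_prod, lintegral_prod_symm _ hm.aemeasurable]
  apply lintegral_congr
  intro y
  apply lintegral_congr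
  intro s
  congr 1
  ext j
  change (Fin.insertNth (α := fun _ => ℝ) i s y) j = _
  rcases eq_or_ne j i with rfl | hj
  · simp [zz]
  · obtain ⟨k, rfl⟩ := Fin.exists_succAbove_eq hj
    simp [zz]

theorem lint_scale {ρ : ℝ} (hρ : 0 < ρ) (H : ℝ → ℝ≥0∞) :
    ∫⁻ s, H s = ENNReal.ofReal ρ * ∫⁻ t, H (ρ * t) := by
  have h := Real.smul_map_volume_mul_left hρ.ne'
  conv_lhs => rw [← h]
  rw [lintegral_smul_measure, abs_of_pos hρ, smul_eq_mul]
  congr 1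
  exact lintegral_map_equiv H (Homeomorph.mulLeft₀ ρ hρ.ne').toMeasurableEquiv

theorem slice_in {d : ℕ} (p μ : ℝ) (h : EE d → ℝ) (i : Fin d) {z : EE d} (hz : z i = 0) (hz1 : ‖z‖ < 1) :
    ∫⁻ s : ℝ, PP p μ h (z + s • eb i) =
      ENNReal.ofReal (Real.sqrt (1 - ‖z‖ ^ 2)) * ENNReal.ofReal ((1 - ‖z‖ ^ 2) ^ (μ - 1 / 2)) *
      ∫⁻ t, ‖h (gam i z t)‖ₑ ^ p ∂(nuM (μ + 1 / 2)) := by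
  have h0 : 0 < 1 - ‖z‖ ^ 2 := by nlinarith [norm_nonneg z]
  rw [lint_scale (Real.sqrt_pos.2 h0), mul_assoc, nu_lint]
  congr 1
  rw [← lintegral_const_mul' _ _ ENNReal.ofReal_ne_top, ← lintegral_indicator measurableSet_Ioo]
  apply lintegral_congr
  intro t
  change PP p μ h (gam i z t) = _
  unfold PP
  by_cases ht : t ∈ Set.Ioo (-1:ℝ) 1
  · rw [Set.indicator_of_mem ht, Set.indicator_of_mem ((gam_ball i hz hz1).2 ht), gam_norm i hz hz1,
      Real.mul_rpow h0.le (pos_of_Ioo ht).le, ENNReal.ofReal_mul (by positivity), mul_assoc,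
      show μ + 1 / 2 - 1 = μ - 1 / 2 by ring]
  · rw [Set.indicator_of_notMem ht, Set.indicator_of_notMem (fun h => ht ((gam_ball i hz hz1).1 h))]

theorem slice_out {d : ℕ} (p μ : ℝ) (h : EE d → ℝ) (i : Fin d) {z : EE d} (hz : z i = 0) (hz1 : ¬ ‖z‖ < 1) :
    ∫⁻ s : ℝ, PP p μ h (z + s • eb i) = 0 := by
  have : ∀ s : ℝ, PP p μ h (z + s • eb i) = 0 := by
    intro s
    apply Set.indicator_of_notMem
    rw [mem_ball_zero_iff]
    intro h1
    have := norm_add_sq' i hz s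
    push Not at hz1
    nlinarith [norm_nonneg (z + s • eb i), sq_nonneg s]
  simp [this]

theorem slice_main {d : ℕ} (p μ : ℝ) (i : Fin d) (h1 h2 h3 : EE d → ℝ) (C : ℝ≥0)
    (c1 : ContinuousOn h1 (ball 0 1)) (c2 : ContinuousOn h2 (ball 0 1)) (c3 : ContinuousOn h3 (ball 0 1))
    (H : ∀ z : EE d, z i = 0 → ‖z‖ < 1 → ∫⁻ t, ‖h1 (gam i z t)‖ₑ ^ p ∂(nuM (μ + 1 / 2)) ≤
      C * (∫⁻ t, ‖h2 (gam i z t)‖ₑ ^ p ∂(nuM (μ + 1 / 2)) + ∫⁻ t, ‖h3 (gam i z t)‖ₑ ^ p ∂(nuM (μ + 1 / 2)))) :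
    ∫⁻ x, PP p μ h1 x ≤ C * ((∫⁻ x, PP p μ h2 x) + ∫⁻ x, PP p μ h3 x) := by
  obtain ⟨n, rfl⟩ : ∃ n, d = n + 1 := ⟨d - 1, by have := i.2; omega⟩
  have m1 := PP_meas p μ c1
  have m2 := PP_meas p μ c2
  have m3 := PP_meas p μ c3
  have m23 : Measurable fun x => PP p μ h2 x + PP p μ h3 x := m2.add m3
  rw [← lintegral_add_left m2, ← lintegral_const_mul _ m23, fub i m1,
    fub i (m23.const_mul _)]
  apply lintegral_mono
  intro y
  have hz := zz_i i y
  have hl : Measurable fun s : ℝ => zz i y + s • eb i := by fun_prop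
  simp only
  rw [lintegral_const_mul' _ _ ENNReal.coe_ne_top]
  rw [lintegral_add_left (by exact m2.comp hl)]
  by_cases hz1 : ‖zz i y‖ < 1
  · rw [slice_in p μ h1 i hz hz1, slice_in p μ h2 i hz hz1, slice_in p μ h3 i hz hz1, ← mul_add,
      ← mul_assoc (C : ℝ≥0∞), mul_comm (C : ℝ≥0∞), mul_assoc _ (C : ℝ≥0∞)]
    gcongr
    exact H _ hz hz1
  · rw [slice_out p μ h1 i hz hz1]
    exact zero_le

theorem NN_lint {p : ℝ} (hp : 1 < p) (κ : ℝ) (m : ℕ) (f : ℝ → ℝ) :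
    NN p κ m f = (∫⁻ t, ‖(1 - t ^ 2) ^ m * f t‖ₑ ^ p ∂(nuM κ)) ^ (1 / p) := by
  have h0 : ENNReal.ofReal p ≠ 0 := by simp; linarith
  unfold NN
  rw [eLpNorm_eq_lintegral_rpow_enorm_toReal h0 ENNReal.ofReal_ne_top, ENNReal.toReal_ofReal (by linarith)]

theorem pow_tr {p : ℝ} (hp : 1 < p) (C : ℝ≥0) {a b c : ℝ≥0∞}
    (h : a ^ (1 / p) ≤ C * (b ^ (1 / p) + c ^ (1 / p))) :
    a ≤ (C ^ p * 2 ^ (p - 1) : ℝ≥0) * (b + c) := by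
  have hp0 : p ≠ 0 := by linarith
  have hpn : 0 ≤ p := by linarith
  have e : ∀ x : ℝ≥0∞, (x ^ (1 / p)) ^ p = x := fun x => by
    rw [← ENNReal.rpow_mul, one_div_mul_cancel hp0, ENNReal.rpow_one]
  calc a = (a ^ (1 / p)) ^ p := (e a).symm
    _ ≤ (C * (b ^ (1 / p) + c ^ (1 / p))) ^ p := by gcongr
    _ = C ^ p * (b ^ (1 / p) + c ^ (1 / p)) ^ p := by rw [ENNReal.mul_rpow_of_nonneg _ _ hpn]
    _ ≤ C ^ p * (2 ^ (p - 1) * ((b ^ (1 / p)) ^ p + (c ^ (1 / p)) ^ p)) := by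
        gcongr
        exact ENNReal.rpow_add_le_mul_rpow_add_rpow _ _ hp.le
    _ = _ := by
        rw [e, e, ENNReal.coe_mul, ENNReal.coe_rpow_of_nonneg _ hpn, ENNReal.coe_rpow_of_nonneg _ (by linarith)]
        rw [mul_assoc]; rfl

theorem pow_tr2 {p : ℝ} (hp : 1 < p) (C : ℝ≥0) {a b c : ℝ≥0∞} (h : a ≤ C * (b + c)) :
    a ^ (1 / p) ≤ (C ^ (1 / p) : ℝ≥0) * (b ^ (1 / p) + c ^ (1 / p)) := by
  have hpn : 0 ≤ 1 / p := by positivity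
  have hp1 : 1 / p ≤ 1 := by rw [div_le_one (by linarith)]; exact hp.le
  calc a ^ (1 / p) ≤ (C * (b + c)) ^ (1 / p) := by gcongr
    _ = (C : ℝ≥0∞) ^ (1 / p) * (b + c) ^ (1 / p) := by rw [ENNReal.mul_rpow_of_nonneg _ _ hpn]
    _ ≤ _ := by
        rw [ENNReal.coe_rpow_of_nonneg _ hpn]
        gcongr
        exact ENNReal.rpow_add_le_add_rpow _ _ hpn hp1

theorem slice_phi {d : ℕ} {p : ℝ} (hp : 1 < p) (κ : ℝ) (i : Fin d) {z : EE d} (hz : z i = 0) (hz1 : ‖z‖ < 1) (r : ℕ)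
    {g : EE d → ℝ} (hg : ContDiffOn ℝ ((2 * r : ℕ) : WithTop ℕ∞) g (ball 0 1)) :
    NN p κ r (dW^[2 * r] (fun t => g (gam i z t))) =
      (∫⁻ t, ‖phiB (gam i z t) ^ (2 * r) * (pder i)^[2 * r] g (gam i z t)‖ₑ ^ p ∂(nuM κ)) ^ (1 / p) := by
  rw [NN_lint hp]
  congr 1
  apply lintegral_congr_ae
  filter_upwards [nu_ae κ] with t ht
  have h0 : 0 < 1 - ‖z‖ ^ 2 := by nlinarith [norm_nonneg z]
  have h1 := pos_of_Ioo ht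
  rw [gam_iter i hz hz1 _ hg t ht, phiB, gam_norm i hz hz1, pow_mul, pow_mul, Real.sq_sqrt h0.le,
    Real.sq_sqrt (by positivity), mul_pow]
  congr 2
  ring

theorem slice_D {d : ℕ} {p : ℝ} (hp : 1 < p) (μ : ℝ) (i : Fin d) {z : EE d} (hz : z i = 0) (hz1 : ‖z‖ < 1) (r : ℕ)
    {g : EE d → ℝ} (hg : ContDiffOn ℝ ((2 * r : ℕ) : WithTop ℕ∞) g (ball 0 1)) :
    NN p (μ + 1 / 2) 0 ((Lop (μ + 1 / 2))^[r] (fun t => g (gam i z t))) =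
      (∫⁻ t, ‖(DiiOp μ i)^[r] g (gam i z t)‖ₑ ^ p ∂(nuM (μ + 1 / 2))) ^ (1 / p) := by
  rw [NN_lint hp]
  congr 1
  apply lintegral_congr_ae
  filter_upwards [nu_ae (μ + 1 / 2)] with t ht
  rw [gam_Lops μ i hz hz1 _ hg t ht, pow_zero, one_mul]

theorem main_aux (d : ℕ) (r : ℕ) (p : ℝ) (hp : 1 < p)
    (μ : ℝ) (hμ : 0 ≤ μ) (i : Fin d) :
    ∃ C : ℝ≥0, ∀ g : EE d → ℝ, ContDiffOn ℝ ((2 * r : ℕ) : WithTop ℕ∞) g (closedBall 0 1) →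
      eLpNorm (fun x => phiB x ^ (2 * r) * (pder i)^[2 * r] g x) (ENNReal.ofReal p) (ballMeasure d μ) ≤
        C * eLpNorm ((DiiOp μ i)^[r] g) (ENNReal.ofReal p) (ballMeasure d μ) ∧
      eLpNorm ((DiiOp μ i)^[r] g) (ENNReal.ofReal p) (ballMeasure d μ) ≤
        C * (eLpNorm (fun x => phiB x ^ (2 * r) * (pder i)^[2 * r] g x) (ENNReal.ofReal p) (ballMeasure d μ) +
          eLpNorm g (ENNReal.ofReal p) (ballMeasure d μ)) := by
  have hκ : 0 < μ + 1 / 2 := by linarith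
  obtain ⟨C1, h1⟩ := lower1D hp (μ + 1 / 2) hκ r
  obtain ⟨C2, h2⟩ := upper1D hp (μ + 1 / 2) hκ r
  have hp0 : 0 < 1 / p := by positivity
  refine ⟨(C1 ^ p * 2 ^ (p - 1)) ^ (1 / p) + (C2 ^ p * 2 ^ (p - 1)) ^ (1 / p), fun g hg => ?_⟩
  have hgb := hg.mono ball_subset_closedBall
  have cg : ContinuousOn g (ball 0 1) := hgb.continuousOn
  have cD : ContinuousOn ((DiiOp μ i)^[r] g) (ball 0 1) :=
    (Dii_iter_cd (n := 0) μ i r (by simpa using hgb)).continuousOn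
  have cP : ContinuousOn (fun x => phiB x ^ (2 * r) * (pder i)^[2 * r] g x) (ball 0 1) := by
    have := (pder_iter_cd (n := 0) i (2 * r) (g := g) (by simpa using hgb)).continuousOn
    have h3 : Continuous (fun x : EE d => phiB x ^ (2 * r)) := by unfold phiB; fun_prop
    exact h3.continuousOn.mul this
  have c0 : ContinuousOn (fun _ : EE d => (0:ℝ)) (ball 0 1) := continuousOn_const
  constructor
  · have := slice_main p μ i _ _ _ (C1 ^ p * 2 ^ (p - 1)) cP cD c0 (fun z hz hz1 => by
      apply pow_tr hp
      have := h1 _ (gam_Sm i hz hz1 hg)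
      rw [slice_phi hp _ i hz hz1 r hgb, slice_D hp μ i hz hz1 r hgb] at this
      exact this.trans (by gcongr; exact le_self_add))
    have := pow_tr2 hp _ this
    rw [← eLp_PP hp, ← eLp_PP hp, ← eLp_PP hp] at this
    simp only [eLpNorm_zero', add_zero] at this
    refine this.trans ?_
    gcongr
    exact le_self_add
  · have := slice_main p μ i _ _ _ (C2 ^ p * 2 ^ (p - 1)) cD cP cg (fun z hz hz1 => by
      apply pow_tr hp
      have := h2 _ (gam_Sm i hz hz1 hg)
      rw [slice_phi hp _ i hz hz1 r hgb, slice_D hp μ i hz hz1 r hgb, NN_lint hp] at this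
      simpa only [pow_zero, one_mul] using this)
    have := pow_tr2 hp _ this
    rw [← eLp_PP hp, ← eLp_PP hp, ← eLp_PP hp] at this
    refine this.trans ?_
    gcongr
    exact le_add_self

/-- for `1 < p < ∞`, `μ ≥ 0` and `g ∈ C^{2r}(B^d)`,
`c₁ ‖φ^{2r} ∂_i^{2r} g‖_{p,μ} ≤ ‖D_{i,i}^{2r} g‖_{p,μ} ≤ c₂ ‖φ^{2r} ∂_i^{2r} g‖_{p,μ} + c₂ ‖g‖_{p,μ}`. -/
theorem stmt_8 (d : ℕ) (hd : 1 ≤ d) (r : ℕ) (hr : 1 ≤ r) (p : ℝ) (hp : 1 < p)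
    (μ : ℝ) (hμ : 0 ≤ μ) (i : Fin d) :
    ∃ c₁ c₂ : ℝ≥0, 0 < c₁ ∧ 0 < c₂ ∧
      ∀ g : EuclideanSpace ℝ (Fin d) → ℝ,
        ContDiffOn ℝ (2 * r) g (Metric.closedBall (0 : EuclideanSpace ℝ (Fin d)) 1) →
        (c₁ : ℝ≥0∞) * eLpNorm (fun x => phiB x ^ (2 * r) * (pder i)^[2 * r] g x)
            (ENNReal.ofReal p) (ballMeasure d μ) ≤
          eLpNorm ((DiiOp μ i)^[r] g) (ENNReal.ofReal p) (ballMeasure d μ) ∧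
        eLpNorm ((DiiOp μ i)^[r] g) (ENNReal.ofReal p) (ballMeasure d μ) ≤
          (c₂ : ℝ≥0∞) * eLpNorm (fun x => phiB x ^ (2 * r) * (pder i)^[2 * r] g x)
              (ENNReal.ofReal p) (ballMeasure d μ)
            + (c₂ : ℝ≥0∞) * eLpNorm g (ENNReal.ofReal p) (ballMeasure d μ) := by
  obtain ⟨C, hC⟩ := main_aux d r p hp μ hμ i
  refine ⟨(C + 1)⁻¹, C + 1, by positivity, by positivity, fun g hg => ?_⟩
  obtain ⟨hL, hU⟩ := hC g (by exact_mod_cast hg)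
  have hCC : (C : ℝ≥0∞) ≤ ((C + 1 : ℝ≥0) : ℝ≥0∞) := by exact_mod_cast le_self_add
  have h0 : (C + 1 : ℝ≥0) ≠ 0 := by positivity
  constructor
  · rw [ENNReal.coe_inv h0]
    calc _ ≤ ((C + 1 : ℝ≥0) : ℝ≥0∞)⁻¹ * (((C + 1 : ℝ≥0) : ℝ≥0∞) *
          eLpNorm ((DiiOp μ i)^[r] g) (ENNReal.ofReal p) (ballMeasure d μ)) := by
          gcongr
          exact hL.trans (by gcongr)
      _ = _ := by
          rw [← mul_assoc, ENNReal.inv_mul_cancel (by exact_mod_cast h0) ENNReal.coe_ne_top, one_mul]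
  · rw [← mul_add]
    exact hU.trans (by gcongr)
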